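/- arXiv:1509.02960 — 14 statements merged into one kernel-verified Lean document; each statement's English description precedes it below -/
import Mathlib

section
/- Let G be a finite group with center Z such that (i) G/Z is an elementary abelian p-group and (ii) for every g ∈ G \ Z the map c_g : G → Z, g' ↦ [g,g'] (the commutator) is surjective. Then for every non-trivial character ψ : Z → ℂ^× there exists an irreducible complex representation ρ_ψ of G whose restriction to Z contains ψ, this representation is unique up to isomorphism, and (dim ρ_ψ)² = [G : Z]. -/
open Representation in
theorem aux_irr {G W : Type} [Group G] [AddCommGroup W] [Module ℂ W] [Nontrivial W]
    (ρ : Representation ℂ G W)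
    (h : ∀ U : Submodule ℂ W, (∀ g w, w ∈ U → ρ g w ∈ U) → U = ⊥ ∨ U = ⊤) :
    IsIrreducible ρ := by
  have : Nontrivial (Subrepresentation ρ) := by
    refine ⟨⟨⊥, ⊤, fun e => ?_⟩⟩
    have e2 : (⊥ : Submodule ℂ W) = ⊤ := congrArg Subrepresentation.toSubmodule e
    exact bot_ne_top e2
  refine ⟨fun a => ?_⟩
  rcases h a.toSubmodule (fun g w hw => a.apply_mem_toSubmodule g hw) with h | h
  · left; exact Subrepresentation.toSubmodule_injective h
  · right; exact Subrepresentation.toSubmodule_injective h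

/-- In an irreducible representation containing `ψ`, the center acts by `ψ`. -/
theorem aux_scalar {G W : Type} [Group G] [AddCommGroup W] [Module ℂ W]
    (ψ : Subgroup.center G →* ℂˣ) (ρ : Representation ℂ G W)
    (h : ∀ U : Submodule ℂ W, (∀ g w, w ∈ U → ρ g w ∈ U) → U = ⊥ ∨ U = ⊤)
    (hw : ∃ w : W, w ≠ 0 ∧ ∀ z : Subgroup.center G, ρ (z : G) w = (ψ z : ℂ) • w)
    (z : Subgroup.center G) (w : W) : ρ (z : G) w = (ψ z : ℂ) • w := by
  let U : Submodule ℂ W :=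
    { carrier := {w | ∀ z : Subgroup.center G, ρ (z : G) w = (ψ z : ℂ) • w}
      add_mem' := fun {a b} ha hb z => by rw [map_add, ha z, hb z, smul_add]
      zero_mem' := fun z => by simp
      smul_mem' := fun c a ha z => by rw [map_smul, ha z, smul_comm] }
  have hU : ∀ g w, w ∈ U → ρ g w ∈ U := by
    intro g w hw z
    have hc : (z : G) * g = g * z := (Subgroup.mem_center_iff.mp z.2 g).symm
    rw [← Module.End.mul_apply, ← map_mul, hc, map_mul, Module.End.mul_apply, hw z, map_smul]
  obtain ⟨w0, h0, h1⟩ := hw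
  rcases h U hU with e | e
  · have : w0 ∈ U := h1
    rw [e] at this
    exact absurd ((Submodule.mem_bot ℂ).mp this) h0
  · have : w ∈ U := by rw [e]; trivial
    exact this z

open Representation in
theorem aux_char_center {G W : Type} [Group G] [AddCommGroup W] [Module ℂ W]
    [FiniteDimensional ℂ W]
    (ψ : Subgroup.center G →* ℂˣ) (ρ : Representation ℂ G W)
    (hs : ∀ (z : Subgroup.center G) (w : W), ρ (z : G) w = (ψ z : ℂ) • w)
    (z : Subgroup.center G) :
    ρ.character (z : G) = (ψ z : ℂ) * Module.finrank ℂ W := by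
  have : ρ (z : G) = (ψ z : ℂ) • (1 : Module.End ℂ W) := by
    ext w; simp [hs]
  simp [character, this]

open Representation in
theorem aux_char_off {G W : Type} [Group G] [AddCommGroup W] [Module ℂ W]
    [FiniteDimensional ℂ W]
    (hcomm : ∀ g : G, g ∉ Subgroup.center G → ∀ z ∈ Subgroup.center G,
      ∃ g' : G, g * g' * g⁻¹ * g'⁻¹ = z)
    (ψ : Subgroup.center G →* ℂˣ) (hψ : ψ ≠ 1) (ρ : Representation ℂ G W)
    (hs : ∀ (z : Subgroup.center G) (w : W), ρ (z : G) w = (ψ z : ℂ) • w)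
    (g : G) (hg : g ∉ Subgroup.center G) :
    ρ.character g = 0 := by
  obtain ⟨z, hz⟩ : ∃ z, ψ z ≠ 1 := by
    by_contra! hcon
    exact hψ (MonoidHom.ext hcon)
  obtain ⟨g', hg'⟩ := hcomm g hg z z.2
  have e : g = (z : G) * (g' * g * g'⁻¹) := by rw [← hg']; group
  have e1 : ρ.character g = (ψ z : ℂ) * ρ.character g := by
    conv_lhs => rw [e]
    have : ρ ((z : G) * (g' * g * g'⁻¹)) = (ψ z : ℂ) • ρ (g' * g * g'⁻¹) := by
      ext w; rw [map_mul, Module.End.mul_apply, hs]; rfl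
    rw [← char_conj ρ g g']
    simp only [character]
    rw [this, map_smul, smul_eq_mul]
  have hz' : (ψ z : ℂ) ≠ 1 := fun h => hz (Units.ext h)
  have : ((ψ z : ℂ) - 1) * ρ.character g = 0 := by rw [sub_mul, one_mul, ← e1, sub_self]
  exact (mul_eq_zero.mp this).resolve_left (sub_ne_zero.mpr hz')

open Representation in
theorem aux_sum {G V W : Type} [Group G] [Fintype G] [AddCommGroup V] [Module ℂ V]
    [FiniteDimensional ℂ V] [AddCommGroup W] [Module ℂ W]
    [FiniteDimensional ℂ W]
    (hcomm : ∀ g : G, g ∉ Subgroup.center G → ∀ z ∈ Subgroup.center G,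
      ∃ g' : G, g * g' * g⁻¹ * g'⁻¹ = z)
    (ψ : Subgroup.center G →* ℂˣ) (hψ : ψ ≠ 1) (ρ : Representation ℂ G V)
    (σ : Representation ℂ G W)
    (hs : ∀ (z : Subgroup.center G) (w : V), ρ (z : G) w = (ψ z : ℂ) • w)
    (hs' : ∀ (z : Subgroup.center G) (w : W), σ (z : G) w = (ψ z : ℂ) • w) :
    ∑ g : G, ρ.character g * σ.character g⁻¹ =
      Nat.card (Subgroup.center G) * (Module.finrank ℂ V * Module.finrank ℂ W) := by
  classical
  have h1 : ∀ g : G, ρ.character g * σ.character g⁻¹ =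
      if g ∈ Subgroup.center G then ((Module.finrank ℂ V : ℂ) * Module.finrank ℂ W) else 0 := by
    intro g
    split_ifs with hg
    · have a := aux_char_center ψ ρ hs ⟨g, hg⟩
      have b := aux_char_center ψ σ hs' (⟨g, hg⟩⁻¹)
      simp only [InvMemClass.coe_inv, map_inv] at a b
      rw [a, b]
      have := (ψ ⟨g, hg⟩).mul_inv
      linear_combination ((Module.finrank ℂ V : ℂ) * Module.finrank ℂ W) * this
    · rw [aux_char_off hcomm ψ hψ ρ hs g hg, zero_mul]
  rw [Finset.sum_congr rfl (fun g _ => h1 g), ← Finset.sum_filter, Finset.sum_const,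
    nsmul_eq_mul]
  congr 2
  rw [Nat.card_eq_fintype_card, Fintype.card_subtype]

/-- Existence of an irreducible representation over `ψ`, inside the regular representation. -/
theorem aux_exists (G : Type) [Group G] [Fintype G] (ψ : Subgroup.center G →* ℂˣ) :
    ∃ (V : Type) (_ : AddCommGroup V) (_ : Module ℂ V),
      FiniteDimensional ℂ V ∧ Nontrivial V ∧
      ∃ ρ : Representation ℂ G V,
        (∀ U : Submodule ℂ V, (∀ g v, v ∈ U → ρ g v ∈ U) → U = ⊥ ∨ U = ⊤) ∧
        (∃ v : V, v ≠ 0 ∧ ∀ z : Subgroup.center G, ρ (z : G) v = (ψ z : ℂ) • v) := by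
  classical
  let R : Representation ℂ G (G → ℂ) :=
    { toFun := fun g => LinearMap.funLeft ℂ ℂ (fun x => x * g)
      map_one' := by ext; simp [LinearMap.funLeft]
      map_mul' := fun a b => by ext; simp [LinearMap.funLeft, mul_assoc] }
  have hR : ∀ g f x, R g f x = f (x * g) := fun g f x => rfl
  let S : Set (Submodule ℂ (G → ℂ)) := {U | U ≠ ⊥ ∧ (∀ g f, f ∈ U → R g f ∈ U) ∧
    ∀ f ∈ U, ∀ z : Subgroup.center G, R (z : G) f = (ψ z : ℂ) • f}
  let U0 : Submodule ℂ (G → ℂ) :=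
    { carrier := {w | ∀ z : Subgroup.center G, R (z : G) w = (ψ z : ℂ) • w}
      add_mem' := fun {a b} ha hb z => by rw [map_add, ha z, hb z, smul_add]
      zero_mem' := fun z => by simp
      smul_mem' := fun c a ha z => by rw [map_smul, ha z, smul_comm] }
  have hS : S.Nonempty := by
    refine ⟨U0, ?_, ?_, fun f hf => hf⟩
    · intro e
      let f : G → ℂ := fun x => if h : x ∈ Subgroup.center G then (ψ ⟨x, h⟩ : ℂ) else 0
      have hf : f ∈ U0 := by
        intro z
        ext x
        rw [hR]
        by_cases hx : x ∈ Subgroup.center G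
        · have hxz : x * z ∈ Subgroup.center G := mul_mem hx z.2
          have : (⟨x * z, hxz⟩ : Subgroup.center G) = z * ⟨x, hx⟩ := by
            exact Subtype.ext (Subgroup.mem_center_iff.mp z.2 x)
          simp only [f, dif_pos hx, dif_pos hxz, Pi.smul_apply, smul_eq_mul, this, map_mul,
            Units.val_mul]
        · have hxz : x * z ∉ Subgroup.center G := fun h =>
            hx ((Subgroup.mul_mem_cancel_right _ z.2).mp h)
          simp [f, dif_neg hx, dif_neg hxz]
      rw [e, Submodule.mem_bot] at hf
      have h1 := congrFun hf 1
      have : (⟨1, one_mem _⟩ : Subgroup.center G) = 1 := rfl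
      simp [f, one_mem, this] at h1
    · intro g w hw z
      have hc : (z : G) * g = g * z := (Subgroup.mem_center_iff.mp z.2 g).symm
      rw [← Module.End.mul_apply, ← map_mul, hc, map_mul, Module.End.mul_apply, hw z, map_smul]
  obtain ⟨U, ⟨hU0, hUinv, hUψ⟩, hmin⟩ :=
    WellFounded.has_min (wellFounded_lt (α := Submodule ℂ (G → ℂ))) S hS
  let σ : Subrepresentation R := ⟨U, fun g v hv => hUinv g v hv⟩
  have hnt : Nontrivial U := Submodule.nontrivial_iff_ne_bot.mpr hU0
  have hσ : ∀ g (v : U), ((σ.toRepresentation g v : U) : G → ℂ) = R g v := fun g v => rfl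
  refine ⟨U, inferInstance, inferInstance, inferInstance, hnt, σ.toRepresentation, ?_, ?_⟩
  · intro T hT
    by_cases hb : T = ⊥
    · exact Or.inl hb
    right
    have hle : T.map U.subtype ≤ U := Submodule.map_subtype_le U T
    have hTS : T.map U.subtype ∈ S := by
      refine ⟨?_, ?_, fun f hf => hUψ f (hle hf)⟩
      · intro e
        refine hb ((Submodule.eq_bot_iff T).mpr fun v hv => Subtype.ext ?_)
        have hm : (v : G → ℂ) ∈ T.map U.subtype := ⟨v, hv, rfl⟩
        rw [e] at hm
        exact (Submodule.mem_bot ℂ).mp hm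
      · rintro g _ ⟨v, hv, rfl⟩
        exact ⟨σ.toRepresentation g v, hT g v hv, rfl⟩
    have heq : T.map U.subtype = U := by
      by_contra hne
      exact hmin _ hTS (lt_of_le_of_ne hle hne)
    rw [eq_top_iff]
    intro v _
    have : (v : G → ℂ) ∈ T.map U.subtype := by rw [heq]; exact v.2
    obtain ⟨w, hw, e⟩ := this
    rwa [← Subtype.ext (a1 := w) (a2 := v) e]
  · obtain ⟨v, hv⟩ := exists_ne (0 : U)
    exact ⟨v, hv, fun z => Subtype.ext (hUψ v v.2 z)⟩

/-- **Heisenberg-type groups have a unique irreducible representation over each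
non-trivial central character.**
Let `G` be a finite group with center `Z` such that `G/Z` is an elementary abelian
`p`-group and, for every `g ∈ G \ Z`, the commutator map `g' ↦ [g, g']` is surjective
onto `Z`.  Then for every non-trivial character `ψ : Z → ℂˣ` there is an irreducible
complex representation `ρ` of `G` whose restriction to `Z` contains `ψ`, it is unique
up to isomorphism, and `(dim ρ)² = [G : Z]`. -/
theorem stmt_0 {p : ℕ} (hp : p.Prime) (G : Type) [Group G] [Fintype G]
    (habel : ∀ x y : G ⧸ Subgroup.center G, x * y = y * x)
    (helem : ∀ x : G ⧸ Subgroup.center G, x ^ p = 1)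
    (hcomm : ∀ g : G, g ∉ Subgroup.center G → ∀ z ∈ Subgroup.center G,
      ∃ g' : G, g * g' * g⁻¹ * g'⁻¹ = z)
    (ψ : Subgroup.center G →* ℂˣ) (hψ : ψ ≠ 1) :
    ∃ (V : Type) (_ : AddCommGroup V) (_ : Module ℂ V),
      FiniteDimensional ℂ V ∧ Nontrivial V ∧
      ∃ ρ : Representation ℂ G V,
        (∀ U : Submodule ℂ V, (∀ g v, v ∈ U → ρ g v ∈ U) → U = ⊥ ∨ U = ⊤) ∧
        (∃ v : V, v ≠ 0 ∧ ∀ z : Subgroup.center G, ρ (z : G) v = (ψ z : ℂ) • v) ∧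
        Module.finrank ℂ V ^ 2 = (Subgroup.center G).index ∧
        (∀ (W : Type) (_ : AddCommGroup W) (_ : Module ℂ W),
          FiniteDimensional ℂ W → Nontrivial W →
          ∀ ρ' : Representation ℂ G W,
            (∀ U : Submodule ℂ W, (∀ g w, w ∈ U → ρ' g w ∈ U) → U = ⊥ ∨ U = ⊤) →
            (∃ w : W, w ≠ 0 ∧ ∀ z : Subgroup.center G, ρ' (z : G) w = (ψ z : ℂ) • w) →
            ∃ eqv : V ≃ₗ[ℂ] W, ∀ g v, eqv (ρ g v) = ρ' g (eqv v)) := by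
  classical
  obtain ⟨V, iV, mV, fV, nV, ρ, hirr, hv⟩ := aux_exists G ψ
  have hs := aux_scalar ψ ρ hirr hv
  have irr := aux_irr ρ hirr
  have hG : (Nat.card G : ℂ) ≠ 0 := by exact_mod_cast Nat.card_pos.ne'
  have hZ : (Nat.card (Subgroup.center G) : ℂ) ≠ 0 := by exact_mod_cast Nat.card_pos.ne'
  letI : Invertible (Nat.card G : ℂ) := invertibleOfNonzero hG
  have hV : (Module.finrank ℂ V : ℂ) ≠ 0 := by exact_mod_cast Module.finrank_pos.ne'
  refine ⟨V, iV, mV, fV, nV, ρ, hirr, hv, ?_, ?_⟩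
  · have h := Representation.char_orthonormal ρ ρ
    rw [aux_sum hcomm ψ hψ ρ ρ hs hs, if_pos ⟨Representation.Equiv.refl ρ⟩,
      inv_mul_eq_one₀ hG] at h
    have h2 : Nat.card G = Nat.card (Subgroup.center G) *
        (Module.finrank ℂ V * Module.finrank ℂ V) := by exact_mod_cast h
    rw [← Subgroup.card_mul_index (Subgroup.center G)] at h2
    rw [sq]
    exact (Nat.eq_of_mul_eq_mul_left Nat.card_pos h2).symm
  · intro W iW mW fW nW ρ' hirr' hw
    have hs' := aux_scalar ψ ρ' hirr' hw
    have irr' := aux_irr ρ' hirr'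
    have hW : (Module.finrank ℂ W : ℂ) ≠ 0 := by exact_mod_cast Module.finrank_pos.ne'
    have h := Representation.char_orthonormal ρ' ρ
    rw [aux_sum hcomm ψ hψ ρ' ρ hs' hs] at h
    by_cases hne : Nonempty (Representation.Equiv ρ ρ')
    · obtain ⟨φ⟩ := hne
      refine ⟨φ.toLinearEquiv, fun g v => ?_⟩
      exact LinearMap.congr_fun (φ.toIntertwiningMap.isIntertwining' g) v
    · rw [if_neg hne] at h
      exact absurd h (mul_ne_zero (inv_ne_zero hG) (mul_ne_zero hZ (mul_ne_zero hW hV)))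
end

section
/- The set Q = { g(a,b,c) : a, b, c ∈ k̄, a^{p^e+1} = 1, b^{p^{2e}} + b = 0, c^p − c + b^{p^e+1} = 0 }, equipped with the multiplication g(a₁,b₁,c₁)·g(a₂,b₂,c₂) = g(a₁a₂, b₁ + a₁b₂, c₁ + c₂ + Σ_{i=0}^{e−1}(a₁ b₁^{p^e} b₂)^{p^i}), is a group, and its order is p^{2e+1}(p^e + 1). -/
/-- The defining conditions on a triple `(a, b, c)` of elements of an algebraic closure
of `𝔽_p`: `a^(p^e+1) = 1`, `b^(p^(2e)) + b = 0`, `c^p − c + b^(p^e+1) = 0`. -/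
def Qcond (p e : ℕ) [Fact p.Prime]
    (x : AlgebraicClosure (ZMod p) × AlgebraicClosure (ZMod p) × AlgebraicClosure (ZMod p)) :
    Prop :=
  x.1 ^ (p ^ e + 1) = 1 ∧ x.2.1 ^ p ^ (2 * e) + x.2.1 = 0 ∧
    x.2.2 ^ p - x.2.2 + x.2.1 ^ (p ^ e + 1) = 0

/-- The carrier of the group `Q`. -/
abbrev Qt (p e : ℕ) [Fact p.Prime] : Type := {x // Qcond p e x}

/-- The multiplication law
`g(a₁,b₁,c₁)·g(a₂,b₂,c₂) = g(a₁a₂, b₁ + a₁b₂, c₁ + c₂ + Σ_{i<e} (a₁ b₁^(p^e) b₂)^(p^i))`. -/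
noncomputable def Qmul (p e : ℕ) [Fact p.Prime]
    (x y : AlgebraicClosure (ZMod p) × AlgebraicClosure (ZMod p) × AlgebraicClosure (ZMod p)) :
    AlgebraicClosure (ZMod p) × AlgebraicClosure (ZMod p) × AlgebraicClosure (ZMod p) :=
  (x.1 * y.1, x.2.1 + x.1 * y.2.1,
    x.2.2 + y.2.2 + ∑ i ∈ Finset.range e, (x.1 * x.2.1 ^ p ^ e * y.2.1) ^ p ^ i)

open Polynomial in
theorem q_card_roots {K : Type*} [Field K] [IsAlgClosed K] (f : K[X]) (hf : f.Separable) :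
    Nat.card {x : K // f.eval x = 0} = f.natDegree := by
  classical
  have h := card_rootSet_eq_natDegree (K := K) hf (IsAlgClosed.splits _)
  rw [← h, ← Nat.card_eq_fintype_card]
  apply Nat.card_congr
  apply Equiv.subtypeEquivRight
  intro x
  rw [mem_rootSet]
  simp [hf.ne_zero]

open Polynomial in
theorem q_sep {K : Type*} [Field K] (f : K[X]) (u : K) (hu : u ≠ 0)
    (h : derivative f = C u) : f.Separable := by
  rw [separable_def, h]
  exact isCoprime_one_right.of_isCoprime_of_dvd_right ((Polynomial.isUnit_C.2 hu.isUnit).dvd)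

section
variable {p : ℕ} [Fact p.Prime] {K : Type*} [Field K] [CharP K p]

theorem q_card_a [IsAlgClosed K] (e : ℕ) (he : 1 ≤ e) :
    Nat.card {x : K // x ^ (p ^ e + 1) = 1} = p ^ e + 1 := by
  open Polynomial in
  have h0 : (p : K) = 0 := CharP.cast_eq_zero K p
  have hs : (X ^ (p ^ e + 1) - C (1 : K)).Separable := by
    apply separable_X_pow_sub_C _ _ one_ne_zero
    push_cast
    rw [h0, zero_pow (by omega)]; simp
  have h := q_card_roots _ hs
  rw [natDegree_X_pow_sub_C] at h
  refine Eq.trans (Nat.card_congr ?_) h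
  apply Equiv.subtypeEquivRight
  intro x
  simp [sub_eq_zero]

theorem q_card_b [IsAlgClosed K] (e : ℕ) (he : 1 ≤ e) :
    Nat.card {x : K // x ^ p ^ (2 * e) + x = 0} = p ^ (2 * e) := by
  open Polynomial in
  have h0 : (p : K) = 0 := CharP.cast_eq_zero K p
  have hp := (Fact.out : p.Prime).two_le
  have hs : (X ^ p ^ (2 * e) + X : K[X]).Separable := by
    apply q_sep _ 1 one_ne_zero
    simp [h0, derivative_X_pow, zero_pow (show 2 * e ≠ 0 by omega), zero_pow (show e ≠ 0 by omega)]
  have h := q_card_roots _ hs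
  have hd : (X ^ p ^ (2 * e) + X : K[X]).natDegree = p ^ (2 * e) := by
    have : 1 < p ^ (2 * e) := Nat.one_lt_pow (by omega) (by omega)
    rw [natDegree_add_eq_left_of_natDegree_lt] <;> simp [this]
  rw [hd] at h
  refine Eq.trans (Nat.card_congr ?_) h
  apply Equiv.subtypeEquivRight
  intro x
  simp

theorem q_card_c [IsAlgClosed K] (d : K) :
    Nat.card {x : K // x ^ p - x + d = 0} = p := by
  open Polynomial in
  have h0 : (p : K) = 0 := CharP.cast_eq_zero K p
  have hp := (Fact.out : p.Prime).two_le
  have hs : (X ^ p - X + C d : K[X]).Separable := by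
    apply q_sep _ (-1) (by simp)
    simp [h0, derivative_X_pow]
  have h := q_card_roots _ hs
  have hd : (X ^ p - X + C d : K[X]).natDegree = p := by
    rw [natDegree_add_C, natDegree_sub_eq_left_of_natDegree_lt] <;> simp
    omega
  rw [hd] at h
  refine Eq.trans (Nat.card_congr ?_) h
  apply Equiv.subtypeEquivRight
  intro x
  simp

/-- The additive trace-like sum. -/
theorem q_S_add (e : ℕ) (x y : K) : ∑ i ∈ Finset.range e, (x + y) ^ p ^ i =
    ∑ i ∈ Finset.range e, x ^ p ^ i + ∑ i ∈ Finset.range e, y ^ p ^ i := by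
  simp [add_pow_char_pow, Finset.sum_add_distrib]

theorem q_S_tel (e : ℕ) (x : K) : (∑ i ∈ Finset.range e, x ^ p ^ i) ^ p =
    ∑ i ∈ Finset.range e, x ^ p ^ i + x ^ p ^ e - x := by
  induction e with
  | zero => simp [(Fact.out : p.Prime).ne_zero]
  | succ n ih => 
    rw [Finset.sum_range_succ, add_pow_char, ih, ← pow_mul, ← pow_succ]; ring

theorem q_neg_pow (e : ℕ) (x : K) : (-x) ^ p ^ e = - x ^ p ^ e := by
  rw [neg_pow, neg_one_pow_char_pow]; ring

theorem q_pow2 (e : ℕ) (b : K) : b ^ p ^ (2 * e) = (b ^ p ^ e) ^ p ^ e := by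
  rw [← pow_mul, ← pow_add, two_mul]

end

theorem q_closed (p e : ℕ) [Fact p.Prime] (x y) (hx : Qcond p e x) (hy : Qcond p e y) :
    Qcond p e (Qmul p e x y) := by
  obtain ⟨a, b, c⟩ := x
  obtain ⟨a', b', c'⟩ := y
  haveI : CharP (AlgebraicClosure (ZMod p)) p := inferInstance
  simp only [Qcond, Qmul] at *
  obtain ⟨h1, h2, h3⟩ := hx
  obtain ⟨k1, k2, k3⟩ := hy
  have e1 := h1
  rw [pow_succ] at e1
  have ea : (a ^ p ^ e) ^ p ^ e = a := by
    have : (a ^ p ^ e * a) ^ p ^ e = 1 := by rw [e1, one_pow]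
    rw [mul_pow] at this
    linear_combination a * this - (a ^ p ^ e) ^ p ^ e * e1
  rw [q_pow2] at h2 k2
  refine ⟨by rw [mul_pow, h1, k1, one_mul], ?_, ?_⟩
  · rw [q_pow2, add_pow_char_pow, add_pow_char_pow, mul_pow, mul_pow, ea]
    linear_combination h2 + a * k2
  · rw [add_pow_char, add_pow_char, q_S_tel, mul_pow, mul_pow, pow_succ (b + a * b'),
      add_pow_char_pow, mul_pow]
    rw [pow_succ] at h3 k3
    linear_combination h3 + k3 + a ^ p ^ e * b' ^ p ^ e * h2 + b' ^ p ^ e * b' * e1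

theorem q_assoc (p e : ℕ) [Fact p.Prime] (x y z) (hx : Qcond p e x) :
    Qmul p e (Qmul p e x y) z = Qmul p e x (Qmul p e y z) := by
  obtain ⟨a, b, c⟩ := x
  obtain ⟨a', b', c'⟩ := y
  obtain ⟨a₂, b₂, c₂⟩ := z
  haveI : CharP (AlgebraicClosure (ZMod p)) p := inferInstance
  simp only [Qcond, Qmul] at *
  obtain ⟨h1, h2, h3⟩ := hx
  rw [pow_succ] at h1
  refine Prod.ext (by ring) (Prod.ext (by simp only; ring) ?_)
  simp only
  have r1 : a * a' * (b + a * b') ^ p ^ e * b₂ = a * a' * b ^ p ^ e * b₂ + a' * b' ^ p ^ e * b₂ := by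
    rw [add_pow_char_pow, mul_pow]
    linear_combination a' * b' ^ p ^ e * b₂ * h1
  have r2 : a * b ^ p ^ e * (b' + a' * b₂) = a * b ^ p ^ e * b' + a * a' * b ^ p ^ e * b₂ := by ring
  rw [r1, r2, q_S_add, q_S_add]
  ring

theorem q_one (p e : ℕ) [Fact p.Prime] : Qcond p e (1, 0, 0) := by
  have := (Fact.out : p.Prime).ne_zero
  simp [Qcond, this]

theorem q_one_mul (p e : ℕ) [Fact p.Prime] (x) : Qmul p e (1, 0, 0) x = x := by
  have := (Fact.out : p.Prime).ne_zero
  simp [Qmul, this]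

/-- The inverse. -/
noncomputable def Qinv (p e : ℕ) [Fact p.Prime]
    (x : AlgebraicClosure (ZMod p) × AlgebraicClosure (ZMod p) × AlgebraicClosure (ZMod p)) :
    AlgebraicClosure (ZMod p) × AlgebraicClosure (ZMod p) × AlgebraicClosure (ZMod p) :=
  (x.1⁻¹, - (x.1⁻¹ * x.2.1),
    - x.2.2 + ∑ i ∈ Finset.range e, (x.2.1 ^ p ^ e * x.2.1) ^ p ^ i)

theorem q_inv (p e : ℕ) [Fact p.Prime] (x) (hx : Qcond p e x) : Qcond p e (Qinv p e x) := by
  obtain ⟨a, b, c⟩ := x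
  haveI : CharP (AlgebraicClosure (ZMod p)) p := inferInstance
  simp only [Qcond, Qinv] at *
  obtain ⟨h1, h2, h3⟩ := hx
  have h1' : a⁻¹ ^ (p ^ e + 1) = 1 := by rw [inv_pow, h1, inv_one]
  have e1 := h1'
  rw [pow_succ] at e1
  have ea : (a⁻¹ ^ p ^ e) ^ p ^ e = a⁻¹ := by
    have : (a⁻¹ ^ p ^ e * a⁻¹) ^ p ^ e = 1 := by rw [e1, one_pow]
    rw [mul_pow] at this
    linear_combination a⁻¹ * this - (a⁻¹ ^ p ^ e) ^ p ^ e * e1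
  rw [q_pow2] at h2
  rw [pow_succ] at h3
  refine ⟨h1', ?_, ?_⟩
  · rw [q_pow2, q_neg_pow, q_neg_pow, mul_pow, mul_pow, ea]
    linear_combination - a⁻¹ * h2
  · have hc : (-c) ^ p = - c ^ p := by simpa using q_neg_pow (p := p) 1 c
    rw [add_pow_char, hc, q_S_tel, pow_succ, q_neg_pow, mul_pow, mul_pow]
    linear_combination - h3 + b ^ p ^ e * h2 + b ^ p ^ e * b * e1

theorem q_inv_mul (p e : ℕ) [Fact p.Prime] (x) (hx : Qcond p e x) :
    Qmul p e (Qinv p e x) x = (1, 0, 0) := by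
  obtain ⟨a, b, c⟩ := x
  haveI : CharP (AlgebraicClosure (ZMod p)) p := inferInstance
  simp only [Qcond, Qinv, Qmul] at *
  obtain ⟨h1, h2, h3⟩ := hx
  have h0 : a ≠ 0 := by rintro rfl; simp at h1
  have e1 : a⁻¹ ^ (p ^ e + 1) = 1 := by rw [inv_pow, h1, inv_one]
  rw [pow_succ] at e1
  refine Prod.ext (by simp [h0]) (Prod.ext (by simp) ?_)
  simp only
  have r : a⁻¹ * (-(a⁻¹ * b)) ^ p ^ e * b = - (b ^ p ^ e * b) := by
    rw [q_neg_pow, mul_pow]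
    linear_combination - b ^ p ^ e * b * e1
  have s := q_S_add (p := p) e (b ^ p ^ e * b) (-(b ^ p ^ e * b))
  have s0 : ∑ i ∈ Finset.range e, (0 : AlgebraicClosure (ZMod p)) ^ p ^ i = 0 := by
    simp [(Fact.out : p.Prime).ne_zero]
  rw [add_neg_cancel, s0] at s
  rw [r]
  linear_combination - s

/-- Splitting the carrier as a product. -/
noncomputable def Qequiv (p e : ℕ) [Fact p.Prime] : Qt p e ≃
    {a : AlgebraicClosure (ZMod p) // a ^ (p ^ e + 1) = 1} ×
    (Σ b : {b : AlgebraicClosure (ZMod p) // b ^ p ^ (2 * e) + b = 0},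
      {c : AlgebraicClosure (ZMod p) // c ^ p - c + b.1 ^ (p ^ e + 1) = 0}) where
  toFun x := (⟨x.1.1, x.2.1⟩, ⟨⟨x.1.2.1, x.2.2.1⟩, ⟨x.1.2.2, x.2.2.2⟩⟩)
  invFun y := ⟨(y.1.1, y.2.1.1, y.2.2.1), y.1.2, y.2.1.2, y.2.2.2⟩
  left_inv _ := rfl
  right_inv _ := rfl

/-- **`Q` is a group of order `p^(2e+1)(p^e + 1)`.**
The set `Q = {g(a,b,c)}` with the multiplication above forms a group, and its
cardinality is `p^(2e+1) * (p^e + 1)`. -/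
theorem stmt_2 (p e : ℕ) [Fact p.Prime] (he : 1 ≤ e) :
    (∃ _ : Group (Qt p e), ∀ a b : Qt p e, (a * b).val = Qmul p e a.val b.val) ∧
      Nat.card (Qt p e) = p ^ (2 * e + 1) * (p ^ e + 1) := by
  constructor
  · letI : Group (Qt p e) :=
      { mul := fun x y => ⟨Qmul p e x.1 y.1, q_closed p e _ _ x.2 y.2⟩
        one := ⟨(1, 0, 0), q_one p e⟩
        inv := fun x => ⟨Qinv p e x.1, q_inv p e _ x.2⟩
        mul_assoc := fun x y z => Subtype.ext (q_assoc p e x.1 y.1 z.1 x.2)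
        one_mul := fun x => Subtype.ext (q_one_mul p e x.1)
        mul_one := fun x => Subtype.ext (by
          have := (Fact.out : p.Prime).ne_zero
          change Qmul p e x.1 (1, 0, 0) = x.1
          simp [Qmul, this])
        inv_mul_cancel := fun x => Subtype.ext (q_inv_mul p e x.1 x.2) }
    exact ⟨this, fun a b => rfl⟩
  · haveI : CharP (AlgebraicClosure (ZMod p)) p := inferInstance
    have hb := q_card_b (p := p) (K := AlgebraicClosure (ZMod p)) e he
    have hp := (Fact.out : p.Prime).pos
    haveI : Finite {b : AlgebraicClosure (ZMod p) // b ^ p ^ (2 * e) + b = 0} :=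
      Nat.finite_of_card_ne_zero (by rw [hb]; positivity)
    letI := Fintype.ofFinite {b : AlgebraicClosure (ZMod p) // b ^ p ^ (2 * e) + b = 0}
    haveI : ∀ b : {b : AlgebraicClosure (ZMod p) // b ^ p ^ (2 * e) + b = 0},
        Finite {c : AlgebraicClosure (ZMod p) // c ^ p - c + b.1 ^ (p ^ e + 1) = 0} := fun b =>
      Nat.finite_of_card_ne_zero (by rw [q_card_c]; positivity)
    rw [Nat.card_congr (Qequiv p e), Nat.card_prod, Nat.card_sigma, q_card_a e he]
    simp only [q_card_c, Finset.sum_const, Finset.card_univ, smul_eq_mul]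
    rw [← Nat.card_eq_fintype_card, hb, pow_succ]
    ring
end

section
/- Let Q₀ = { g(1,b,c) ∈ Q } and let F = { g(1,0,c) ∈ Q : c ∈ F_p }. Then for every element g = g(1,b,c) ∈ Q₀ with b ≠ 0, the map Q₀ → F sending g' to the commutator [g, g'] is surjective. -/
open Polynomial in
theorem exists_root_of_coeff_one {K : Type*} [Field K] [IsAlgClosed K] (P : K[X])
    (h : P.coeff 1 ≠ 0) : ∃ x, P.eval x = 0 := by
  apply IsAlgClosed.exists_root P
  intro hd
  rw [Polynomial.eq_C_of_degree_eq_zero hd] at h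
  simp [Polynomial.coeff_C] at h

open Polynomial in
theorem exists_trace_root {K : Type*} [Field K] [IsAlgClosed K] (p e : ℕ) (hp : 1 < p)
    (he : 1 ≤ e) (c : K) : ∃ t : K, ∑ i ∈ Finset.range e, t ^ p ^ i = c := by
  obtain ⟨t, ht⟩ := exists_root_of_coeff_one
    (∑ i ∈ Finset.range e, (X : K[X]) ^ p ^ i - C c) (by
      rw [coeff_sub, finsetSum_coeff, Finset.sum_eq_single 0]
      · simp [coeff_C]
      · intro i _ hi
        rw [coeff_X_pow, if_neg]
        exact (Nat.one_lt_pow hi hp).ne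
      · intro h
        exact absurd (Finset.mem_range.2 he) h)
  refine ⟨t, ?_⟩
  rw [eval_sub, eval_finsetSum] at ht
  simpa [sub_eq_zero] using ht

open Polynomial in
theorem exists_root_two {K : Type*} [Field K] [IsAlgClosed K] (q : ℕ) (hq : 1 < q)
    (b b' t : K) (hb : b ≠ 0) : ∃ x : K, b * x - b' * x ^ q = t := by
  obtain ⟨x, hx⟩ := exists_root_of_coeff_one
    (C b * X - C b' * X ^ q - C t) (by
      simp [coeff_C, coeff_X_pow, hq.ne, hb])
  refine ⟨x, ?_⟩
  simpa [sub_eq_zero] using hx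

theorem trace_telescope {K : Type*} [Field K] (p e : ℕ) [Fact p.Prime] [CharP K p] (t : K) :
    (∑ i ∈ Finset.range e, t ^ p ^ i) ^ p - ∑ i ∈ Finset.range e, t ^ p ^ i = t ^ p ^ e - t := by
  rw [sum_pow_char, ← Finset.sum_sub_distrib]
  simp only [← pow_mul, ← pow_succ]
  rw [Finset.sum_range_sub (fun i => t ^ p ^ i)]
  simp

theorem trace_sub {K : Type*} [Field K] (p e : ℕ) [Fact p.Prime] [CharP K p] (s t : K) :
    ∑ i ∈ Finset.range e, (s - t) ^ p ^ i =
      ∑ i ∈ Finset.range e, s ^ p ^ i - ∑ i ∈ Finset.range e, t ^ p ^ i := by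
  rw [← Finset.sum_sub_distrib]
  exact Finset.sum_congr rfl fun i _ => sub_pow_char_pow s t i

/-- **Surjectivity of commutator maps on `Q₀`.**
Here `Q` is regarded as a group (with the multiplication law `Qmul`),
`Q₀ = {g(1,b,c) ∈ Q}` and `F = {g(1,0,c) ∈ Q : c ∈ 𝔽_p}` (an element `c` of the
algebraic closure lies in `𝔽_p` iff `c^p = c`).  For every `g = g(1,b,c) ∈ Q₀` with
`b ≠ 0`, the map `Q₀ → F`, `g' ↦ [g,g']` is well defined and surjective. -/
theorem stmt_3 (p e : ℕ) [Fact p.Prime] (he : 1 ≤ e) [Group (Qt p e)]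
    (hmul : ∀ a b : Qt p e, (a * b).val = Qmul p e a.val b.val)
    (g : Qt p e) (hg1 : g.val.1 = 1) (hgb : g.val.2.1 ≠ 0) :
    (∀ g' : Qt p e, g'.val.1 = 1 →
      (g * g' * g⁻¹ * g'⁻¹).val.1 = 1 ∧ (g * g' * g⁻¹ * g'⁻¹).val.2.1 = 0 ∧
        (g * g' * g⁻¹ * g'⁻¹).val.2.2 ^ p = (g * g' * g⁻¹ * g'⁻¹).val.2.2) ∧
    (∀ z : Qt p e, z.val.1 = 1 → z.val.2.1 = 0 → z.val.2.2 ^ p = z.val.2.2 →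
      ∃ g' : Qt p e, g'.val.1 = 1 ∧ g * g' * g⁻¹ * g'⁻¹ = z) := by
  have hp : p.Prime := Fact.out
  have : CharP (AlgebraicClosure (ZMod p)) p := inferInstance
  have hz0 : ∀ y : AlgebraicClosure (ZMod p),
      ∑ i ∈ Finset.range e, ((0 : AlgebraicClosure (ZMod p)) ^ p ^ e * y) ^ p ^ i = 0 := by
    intro y
    apply Finset.sum_eq_zero
    intro i _
    rw [zero_pow (pow_ne_zero _ hp.ne_zero), zero_mul, zero_pow (pow_ne_zero _ hp.ne_zero)]
  constructor
  · intro g' hg'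
    have key : (g * g' * g⁻¹ * g'⁻¹) * (g' * g) = g * g' := by group
    generalize g * g' * g⁻¹ * g'⁻¹ = z at key ⊢
    have hv := congrArg Subtype.val key
    rw [hmul, hmul, hmul] at hv
    have h1 := congrArg Prod.fst hv
    have h2 := congrArg (fun v => v.2.1) hv
    simp only [Qmul, hg1, hg', mul_one] at h1
    simp only [Qmul, hg1, hg', h1, one_mul] at h2
    have h2' : z.val.2.1 = 0 := by linear_combination h2
    refine ⟨h1, h2', ?_⟩
    have h3 := z.2.2.2
    rw [h2', zero_pow (Nat.succ_ne_zero _), add_zero] at h3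
    exact sub_eq_zero.1 h3
  · intro z hz1 hz2 hz3
    obtain ⟨t, ht⟩ := exists_trace_root p e hp.one_lt he z.val.2.2
    obtain ⟨x, hx⟩ := exists_root_two (p ^ e) (Nat.one_lt_pow (by omega) hp.one_lt)
      (g.val.2.1 ^ p ^ e) g.val.2.1 t (pow_ne_zero _ hgb)
    have hb := g.2.2.1
    have hee : p ^ (2 * e) = p ^ e * p ^ e := by rw [two_mul, pow_add]
    have hxx : x ^ p ^ (2 * e) + x = 0 := by
      have h := trace_telescope p e t
      rw [ht, hz3, sub_self, ← hx, sub_pow_char_pow, mul_pow, mul_pow, ← pow_mul, ← pow_mul,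
        ← hee] at h
      have : g.val.2.1 ^ p ^ e * (x ^ p ^ (2 * e) + x) = 0 := by
        linear_combination h + x ^ p ^ e * hb
      exact (mul_eq_zero.1 this).resolve_left (pow_ne_zero _ hgb)
    obtain ⟨c, hc⟩ := exists_root_two p hp.one_lt (-1) (-1) (-x ^ (p ^ e + 1))
      (neg_ne_zero.2 (one_ne_zero (α := AlgebraicClosure (ZMod p))))
    let g' : Qt p e := ⟨(1, x, c), by simp, hxx, by
      show c ^ p - c + x ^ (p ^ e + 1) = 0
      linear_combination hc⟩
    refine ⟨g', rfl, ?_⟩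
    have key : g * g' = z * (g' * g) := by
      apply Subtype.ext
      rw [hmul, hmul, hmul]
      have hs : ∑ i ∈ Finset.range e, (g.val.2.1 ^ p ^ e * x) ^ p ^ i
          = z.val.2.2 + ∑ i ∈ Finset.range e, (x ^ p ^ e * g.val.2.1) ^ p ^ i := by
        rw [← ht, ← hx, trace_sub, mul_comm g.val.2.1 (x ^ p ^ e)]
        ring
      refine Prod.ext ?_ (Prod.ext ?_ ?_)
      · simp [Qmul, hg1, hz1, g']
      · simp only [Qmul, hg1, hz1, hz2, g']
        ring
      · simp only [Qmul, hg1, hz1, hz2, g', one_mul, hz0, hs]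
        ring
    rw [mul_assoc (g * g'), ← mul_inv_rev, key, mul_inv_cancel_right]
end

section
/- Let p be a prime, e ≥ 1, and let k̄ be an algebraic closure of F_p. Let W = { b ∈ k̄ : b^{p^{2e}} + b = 0 }. If b₁ ∈ W and b₁ ≠ 0, then the map W → F_{p^e} sending b₂ to b₁^{p^e} b₂ − b₁ b₂^{p^e} is well defined (its values lie in the subfield F_{p^e} of k̄) and surjective onto F_{p^e}. -/
/-- **Surjectivity onto `𝔽_{p^e}` of `b₂ ↦ b₁^(p^e) b₂ − b₁ b₂^(p^e)` on
`W = {b : b^(p^(2e)) + b = 0}`.**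
Let `k̄` be an algebraic closure of `𝔽_p` and `W = {b ∈ k̄ : b^(p^(2e)) + b = 0}`.
If `b₁ ∈ W` is non-zero, then for every `b₂ ∈ W` the element
`b₁^(p^e) b₂ − b₁ b₂^(p^e)` lies in the subfield `𝔽_{p^e}` (the fixed field of the
`e`-th power of Frobenius), and every element of `𝔽_{p^e}` arises this way. -/
theorem stmt_4 (p e : ℕ) [Fact p.Prime] (he : 1 ≤ e)
    (b₁ : AlgebraicClosure (ZMod p)) (hb₁W : b₁ ^ p ^ (2 * e) + b₁ = 0) (hb₁ : b₁ ≠ 0) :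
    (∀ b₂ : AlgebraicClosure (ZMod p), b₂ ^ p ^ (2 * e) + b₂ = 0 →
      (b₁ ^ p ^ e * b₂ - b₁ * b₂ ^ p ^ e) ^ p ^ e = b₁ ^ p ^ e * b₂ - b₁ * b₂ ^ p ^ e) ∧
    (∀ y : AlgebraicClosure (ZMod p), y ^ p ^ e = y →
      ∃ b₂ : AlgebraicClosure (ZMod p), b₂ ^ p ^ (2 * e) + b₂ = 0 ∧
        b₁ ^ p ^ e * b₂ - b₁ * b₂ ^ p ^ e = y) := by
  have hp : p.Prime := Fact.out
  have hq : 1 < p ^ e := Nat.one_lt_pow (by omega) hp.one_lt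
  have h2 : ∀ x : AlgebraicClosure (ZMod p), x ^ p ^ (2 * e) = (x ^ p ^ e) ^ p ^ e := by
    intro x
    rw [← pow_mul, ← pow_add, two_mul]
  have : CharP (AlgebraicClosure (ZMod p)) p :=
    charP_of_injective_algebraMap (algebraMap (ZMod p) (AlgebraicClosure (ZMod p))).injective p
  have key : ∀ x : AlgebraicClosure (ZMod p),
      (b₁ ^ p ^ e * x - b₁ * x ^ p ^ e) ^ p ^ e
        = -b₁ * x ^ p ^ e - b₁ ^ p ^ e * x ^ p ^ (2 * e) := by
    intro x
    rw [sub_pow_char_pow, mul_pow, mul_pow, ← h2, ← h2, eq_neg_of_add_eq_zero_left hb₁W]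
  refine ⟨?_, ?_⟩
  · intro x hx
    rw [key, eq_neg_of_add_eq_zero_left hx]
    ring
  · intro y hy
    have hdeg : (Polynomial.C (-b₁) * Polynomial.X ^ p ^ e +
        (Polynomial.C (b₁ ^ p ^ e) * Polynomial.X + Polynomial.C (-y))).degree =
        ((p ^ e : ℕ) : WithBot ℕ) := by
      rw [Polynomial.degree_add_eq_left_of_degree_lt]
      · exact Polynomial.degree_C_mul_X_pow _ (neg_ne_zero.mpr hb₁)
      · rw [Polynomial.degree_C_mul_X_pow _ (neg_ne_zero.mpr hb₁)]
        exact lt_of_le_of_lt Polynomial.degree_linear_le (by exact_mod_cast hq)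
    obtain ⟨x, hx⟩ := IsAlgClosed.exists_root (Polynomial.C (-b₁) * Polynomial.X ^ p ^ e +
        (Polynomial.C (b₁ ^ p ^ e) * Polynomial.X + Polynomial.C (-y))) (by
      rw [hdeg]
      exact_mod_cast (by omega : p ^ e ≠ 0))
    simp only [Polynomial.IsRoot, Polynomial.eval_add, Polynomial.eval_mul, Polynomial.eval_C,
      Polynomial.eval_pow, Polynomial.eval_X] at hx
    have hxy : b₁ ^ p ^ e * x - b₁ * x ^ p ^ e = y := by linear_combination hx
    refine ⟨x, ?_, hxy⟩
    have hk := key x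
    rw [hxy, hy] at hk
    have h0 : b₁ ^ p ^ e * (x ^ p ^ (2 * e) + x) = 0 := by linear_combination hxy + hk
    exact (mul_eq_zero.mp h0).resolve_left (pow_ne_zero _ hb₁)
end

section
/- The commutator subgroup of Q equals Q₀ = { g(1,b,c) ∈ Q }; equivalently, the abelianization of Q is the quotient Q/Q₀, which is cyclic of order p^e + 1 via g(a,b,c) ↦ a. -/
section Helpers

open Polynomial in
lemma exists_trace_ne_zero {K : Type*} [Field K] [IsAlgClosed K] (p n : ℕ) [Fact p.Prime]
    [CharP K p] (hn : 1 ≤ n) :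
    ∃ x : K, x ^ p ^ n = x ∧ ∑ i ∈ Finset.range n, x ^ p ^ i ≠ 0 := by
  classical
  have hp : p.Prime := Fact.out
  by_contra! hcon
  set A : K[X] := X ^ p ^ n - X with hA
  set P : K[X] := ∑ i ∈ Finset.range n, X ^ p ^ i with hP
  have h1 : 1 < p ^ n := Nat.one_lt_pow (by omega) hp.one_lt
  have hsep : A.Separable := galois_poly_separable p (p ^ n) (dvd_pow_self p (by omega))
  have hdeg : A.natDegree = p ^ n := FiniteField.X_pow_card_sub_X_natDegree_eq K h1
  have hcard : A.roots.card = p ^ n := by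
    rw [← hdeg]; exact ((IsAlgClosed.splits A).natDegree_eq_card_roots).symm
  have hP0 : P ≠ 0 := by
    intro h
    have h2 : P.coeff 1 = 1 := by
      rw [hP, finsetSum_coeff, Finset.sum_eq_single 0]
      · simp
      · intro b _ hb
        rw [coeff_X_pow, if_neg]
        exact (Nat.one_lt_pow hb hp.one_lt).ne
      · intro h; simp at h; omega
    rw [h] at h2; simp at h2
  have hle : A.roots ≤ P.roots := by
    rw [Multiset.le_iff_subset (nodup_roots hsep)]
    intro x hx
    rw [mem_roots hP0, IsRoot, hP, eval_finsetSum]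
    have := (mem_roots'.1 hx).2
    simp only [hA, IsRoot, eval_sub, eval_pow, eval_X] at this
    simpa using hcon x (sub_eq_zero.1 this)
  have hPd : P.natDegree ≤ p ^ (n - 1) := by
    rw [hP]
    apply natDegree_sum_le_of_forall_le
    intro i hi
    rw [natDegree_X_pow]
    exact Nat.pow_le_pow_right hp.pos (by simp at hi; omega)
  have := (Multiset.card_le_card hle).trans (P.card_roots'.trans hPd)
  rw [hcard] at this
  exact absurd this (not_le.2 (Nat.pow_lt_pow_right hp.one_lt (by omega)))

open Polynomial in
lemma exists_artin_schreier {K : Type*} [Field K] [IsAlgClosed K] (p : ℕ) [Fact p.Prime] (d : K) :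
    ∃ c : K, c ^ p - c + d = 0 := by
  have hp : p.Prime := Fact.out
  have h : (X ^ p - X + C d : K[X]).degree ≠ 0 := by
    have h1 : (X ^ p - X + C d : K[X]).degree = p := by
      have : (X ^ p - X + C d : K[X]) = X ^ p - (X - C d) := by ring
      rw [this, degree_sub_eq_left_of_degree_lt]
      · simp
      · rw [degree_X_pow, degree_X_sub_C]; exact_mod_cast hp.one_lt
    rw [h1]; exact_mod_cast hp.ne_zero
  obtain ⟨x, hx⟩ := IsAlgClosed.exists_root _ h
  exact ⟨x, by simpa using hx⟩

lemma neg_pow_char_pow' {K : Type*} [Field K] (p n : ℕ) [Fact p.Prime] [CharP K p] (x : K) :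
    (-x) ^ p ^ n = -x ^ p ^ n := by
  have := map_neg (iterateFrobenius K p n) x
  simpa [iterateFrobenius_def] using this

lemma sub_pow_char_pow'' {K : Type*} [Field K] (p n : ℕ) [Fact p.Prime] [CharP K p] (x y : K) :
    (x - y) ^ p ^ n = x ^ p ^ n - y ^ p ^ n := by
  have := map_sub (iterateFrobenius K p n) x y
  simpa [iterateFrobenius_def] using this

/-- There are `b₁, b₂` whose commutator is a nontrivial central element. -/
lemma exists_pairing_ne {K : Type*} [Field K] [IsAlgClosed K] (p e : ℕ) [Fact p.Prime]
    [CharP K p] (he : 1 ≤ e) :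
    ∃ b₁ b₂ : K, b₁ ^ p ^ (2 * e) + b₁ = 0 ∧ b₂ ^ p ^ (2 * e) + b₂ = 0 ∧
      ∑ i ∈ Finset.range e, (b₁ ^ p ^ e * b₂) ^ p ^ i ≠
      ∑ i ∈ Finset.range e, (b₂ ^ p ^ e * b₁) ^ p ^ i := by
  have hp : p.Prime := Fact.out
  have h1 : 1 < p ^ (2 * e) := Nat.one_lt_pow (by omega) hp.one_lt
  obtain ⟨b, hb⟩ := IsAlgClosed.exists_pow_nat_eq (-1 : K) (n := p ^ (2 * e) - 1) (by omega)
  have hb0 : b ≠ 0 := by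
    rintro rfl
    rw [zero_pow (by omega)] at hb
    exact one_ne_zero (neg_eq_zero.1 hb.symm)
  have hbV : b ^ p ^ (2 * e) = -b := by
    have : p ^ (2 * e) = (p ^ (2 * e) - 1) + 1 := by omega
    rw [this, pow_succ, hb]; ring
  obtain ⟨x, hx, hxt⟩ := exists_trace_ne_zero (K := K) p (2 * e) (by omega)
  have hc : (b ^ p ^ e) ^ p ^ (2 * e) = - b ^ p ^ e := by
    rw [← pow_mul, mul_comm, pow_mul, hbV, neg_pow_char_pow']
  have hc0 : b ^ p ^ e ≠ 0 := pow_ne_zero _ hb0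
  refine ⟨b, x / b ^ p ^ e, by rw [hbV]; ring, ?_, ?_⟩
  · rw [div_pow, hx, hc, div_neg]; ring
  · rw [mul_div_cancel₀ _ hc0]
    intro h
    apply hxt
    have h2 : (x / b ^ p ^ e) ^ p ^ e * b = - x ^ p ^ e := by
      rw [div_pow, ← pow_mul, ← pow_add, ← two_mul, hbV, div_neg]
      field_simp
    rw [h2] at h
    rw [two_mul, Finset.sum_range_add, h, ← Finset.sum_add_distrib]
    apply Finset.sum_eq_zero
    intro i _
    rw [neg_pow_char_pow', pow_add, pow_mul]; ring

lemma exists_natCast_of_pow_eq {K : Type*} [Field K] (p : ℕ) [Fact p.Prime]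
    [CharP K p] (x : K) (hx : x ^ p = x) : ∃ n : ℕ, (n : K) = x := by
  have h := (Subfield.mem_bot_iff_pow_eq_self K p).2 hx
  obtain ⟨m, rfl⟩ := (mem_bot_iff_intCast p K).1 h
  refine ⟨(m : ZMod p).val, ?_⟩
  have := congrArg (ZMod.castHom (dvd_refl p) K) (ZMod.natCast_zmod_val (m : ZMod p))
  simpa only [map_natCast, map_intCast] using this

open scoped commutatorElement in
lemma mem_comm_of_mul_eq {G : Type*} [Group G] {x y u : G} (h : x * y = u * (y * x)) :
    u ∈ commutator G := by
  have : u = ⁅x, y⁆ := by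
    rw [commutatorElement_def, eq_mul_inv_iff_mul_eq, eq_mul_inv_iff_mul_eq, mul_assoc, h]
  rw [this, commutator_def]
  exact Subgroup.commutator_mem_commutator (Subgroup.mem_top _) (Subgroup.mem_top _)

end Helpers

section Main

variable {p e : ℕ} [Fact p.Prime] [Group (Qt p e)]

lemma Q_fst (hmul : ∀ a b : Qt p e, (a * b).val = Qmul p e a.val b.val) (x y : Qt p e) :
    (x * y).val.1 = x.val.1 * y.val.1 := by rw [hmul]; rfl

lemma Q_snd (hmul : ∀ a b : Qt p e, (a * b).val = Qmul p e a.val b.val) (x y : Qt p e) :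
    (x * y).val.2.1 = x.val.2.1 + x.val.1 * y.val.2.1 := by rw [hmul]; rfl

lemma Q_trd (hmul : ∀ a b : Qt p e, (a * b).val = Qmul p e a.val b.val) (x y : Qt p e) :
    (x * y).val.2.2 = x.val.2.2 + y.val.2.2 +
      ∑ i ∈ Finset.range e, (x.val.1 * x.val.2.1 ^ p ^ e * y.val.2.1) ^ p ^ i := by
  rw [hmul]; rfl

lemma Q_ne_zero (x : Qt p e) : x.val.1 ≠ 0 := by
  intro h
  have := x.2.1
  rw [h, zero_pow (by omega)] at this
  exact zero_ne_one this

lemma Q_one (hmul : ∀ a b : Qt p e, (a * b).val = Qmul p e a.val b.val) :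
    (1 : Qt p e).val = (1, 0, 0) := by
  have hp : p.Prime := Fact.out
  have h1 := Q_fst hmul 1 1
  have h2 := Q_snd hmul 1 1
  have h3 := Q_trd hmul 1 1
  rw [mul_one] at h1 h2 h3
  have e1 : (1 : Qt p e).val.1 = 1 := (mul_eq_left₀ (Q_ne_zero _)).1 h1.symm
  have e2 : (1 : Qt p e).val.2.1 = 0 := by
    rw [e1, one_mul] at h2; exact left_eq_add.1 h2
  have e3 : (1 : Qt p e).val.2.2 = 0 := by
    rw [e2] at h3
    simpa [hp.ne_zero] using h3
  exact Prod.ext e1 (Prod.ext e2 e3)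

noncomputable def Qhom (hmul : ∀ a b : Qt p e, (a * b).val = Qmul p e a.val b.val) :
    Qt p e →* AlgebraicClosure (ZMod p) where
  toFun x := x.val.1
  map_one' := by rw [Q_one hmul]
  map_mul' := Q_fst hmul

lemma Q_exists (a b : AlgebraicClosure (ZMod p)) (ha : a ^ (p ^ e + 1) = 1)
    (hb : b ^ p ^ (2 * e) + b = 0) : ∃ x : Qt p e, x.val.1 = a ∧ x.val.2.1 = b := by
  obtain ⟨c, hc⟩ := exists_artin_schreier p (b ^ (p ^ e + 1))
  exact ⟨⟨(a, b, c), ha, hb, hc⟩, rfl, rfl⟩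

lemma Q_central (hmul : ∀ a b : Qt p e, (a * b).val = Qmul p e a.val b.val) (he : 1 ≤ e)
    (x : Qt p e) (h1 : x.val.1 = 1) (h2 : x.val.2.1 = 0) : x ∈ commutator (Qt p e) := by
  have hp : p.Prime := Fact.out
  obtain ⟨b₁, b₂, hb₁, hb₂, hne⟩ := exists_pairing_ne (K := AlgebraicClosure (ZMod p)) p e he
  obtain ⟨y₁, hy₁, hy₁'⟩ := Q_exists (e := e) 1 b₁ (one_pow _) hb₁
  obtain ⟨y₂, hy₂, hy₂'⟩ := Q_exists (e := e) 1 b₂ (one_pow _) hb₂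
  obtain ⟨t, ht⟩ : ∃ t : Qt p e, y₁ * y₂ = t * (y₂ * y₁) :=
    ⟨y₁ * y₂ * (y₂ * y₁)⁻¹, by group⟩
  have htc := mem_comm_of_mul_eq ht
  have t1 : t.val.1 = 1 := by
    have := congrArg (fun z : Qt p e => z.val.1) ht
    simp only [Q_fst hmul, hy₁, hy₂, mul_one] at this
    exact this.symm
  have t2 : t.val.2.1 = 0 := by
    have := congrArg (fun z : Qt p e => z.val.2.1) ht
    simp only [Q_snd hmul, hy₁, hy₂, hy₁', hy₂', t1, one_mul] at this
    linear_combination -this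
  have t3 : t.val.2.2 ≠ 0 := by
    intro h0
    have := congrArg (fun z : Qt p e => z.val.2.2) ht
    simp only [Q_trd hmul, hy₁, hy₂, hy₁', hy₂', t1, t2, h0, one_mul] at this
    apply hne
    simp [hp.ne_zero] at this
    linear_combination this
  have fix : ∀ z : Qt p e, z.val.2.1 = 0 → z.val.2.2 ^ p = z.val.2.2 := by
    intro z hz
    have := z.2.2.2
    rw [hz] at this
    rw [zero_pow (by omega)] at this
    linear_combination this
  obtain ⟨n, hn⟩ := exists_natCast_of_pow_eq p (x.val.2.2 / t.val.2.2)
    (by rw [div_pow, fix x h2, fix t t2])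
  have hpow : ∀ m : ℕ, (t ^ m).val = (1, 0, m * t.val.2.2) := by
    intro m
    induction m with
    | zero => rw [pow_zero, Q_one hmul]; simp
    | succ m ih =>
      rw [pow_succ, hmul, ih]
      refine Prod.ext ?_ (Prod.ext ?_ ?_)
      · simp [Qmul, t1]
      · simp [Qmul, t2]
      · simp [Qmul, t2, hp.ne_zero]; ring
  have : x = t ^ n := by
    apply Subtype.ext
    rw [hpow, hn, div_mul_cancel₀ _ t3, ← h1, ← h2]
  rw [this]
  exact Subgroup.pow_mem _ htc n

lemma neZero_card (p e : ℕ) [Fact p.Prime] (he : 1 ≤ e) :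
    NeZero ((p ^ e + 1 : ℕ) : AlgebraicClosure (ZMod p)) := by
  refine ⟨?_⟩
  have : e ≠ 0 := by omega
  simp [this]

lemma Q_kernel (hmul : ∀ a b : Qt p e, (a * b).val = Qmul p e a.val b.val) (he : 1 ≤ e)
    (x : Qt p e) (h1 : x.val.1 = 1) : x ∈ commutator (Qt p e) := by
  have hp : p.Prime := Fact.out
  have := neZero_card p e he
  obtain ⟨a, ha⟩ := HasEnoughRootsOfUnity.exists_primitiveRoot (AlgebraicClosure (ZMod p))
    (p ^ e + 1)
  have haq : a ^ (p ^ e + 1) = 1 := ha.pow_eq_one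
  have hpos : 0 < p ^ e := pow_pos hp.pos e
  have ha1 : a - 1 ≠ 0 := sub_ne_zero.2 (ha.ne_one (by omega))
  have haqq : a ^ p ^ (2 * e) = a := by
    have : p ^ (2 * e) = (p ^ e + 1) * (p ^ e - 1) + 1 := by
      obtain ⟨k, hk⟩ : ∃ k, p ^ e = k + 1 := ⟨p ^ e - 1, by omega⟩
      rw [two_mul, pow_add, hk]; simp; ring
    rw [this, pow_succ, pow_mul, haq, one_pow, one_mul]
  have hxb := x.2.2.1
  set b := x.val.2.1 / (a - 1) with hb
  have hb2 : b ^ p ^ (2 * e) + b = 0 := by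
    rw [hb, div_pow, sub_pow_char_pow'', haqq, one_pow, ← add_div, hxb, zero_div]
  obtain ⟨y, hy1, hy2⟩ := Q_exists (e := e) 1 b (one_pow _) hb2
  have hg0 : (0 : AlgebraicClosure (ZMod p)) ^ p ^ (2 * e) + 0 = 0 := by
    simp [hp.ne_zero]
  obtain ⟨g, hg1, hg2⟩ := Q_exists (e := e) a 0 haq hg0
  obtain ⟨u, hu⟩ : ∃ u : Qt p e, g * y = u * (y * g) := ⟨g * y * (y * g)⁻¹, by group⟩
  have huc := mem_comm_of_mul_eq hu
  have ha0 : a ≠ 0 := hg1 ▸ Q_ne_zero g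
  have u1 : u.val.1 = 1 := by
    have := congrArg (fun z : Qt p e => z.val.1) hu
    simp only [Q_fst hmul, hg1, hy1, mul_one, one_mul] at this
    exact (mul_eq_right₀ ha0).1 this.symm
  have u2 : u.val.2.1 = x.val.2.1 := by
    have := congrArg (fun z : Qt p e => z.val.2.1) hu
    simp only [Q_snd hmul, hg1, hy1, hg2, hy2, u1, one_mul, mul_zero, add_zero] at this
    have h3 : b * (a - 1) = x.val.2.1 := div_mul_cancel₀ _ ha1
    linear_combination -this + h3
  obtain ⟨t, ht⟩ : ∃ t : Qt p e, x = u * t := ⟨u⁻¹ * x, by group⟩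
  rw [ht]
  refine Subgroup.mul_mem _ huc (Q_central hmul he t ?_ ?_)
  · have := congrArg (fun z : Qt p e => z.val.1) ht
    simp only [Q_fst hmul, h1, u1, one_mul] at this
    exact this.symm
  · have := congrArg (fun z : Qt p e => z.val.2.1) ht
    simp only [Q_snd hmul, u1, u2, one_mul] at this
    exact left_eq_add.1 this

end Main

/-- **The commutator subgroup of `Q` is `Q₀` and the abelianization is cyclic of order
`p^e + 1` via `g(a,b,c) ↦ a`.**
Here `Q` is regarded as a group with the multiplication law `Qmul`, and
`Q₀ = {g(1,b,c) ∈ Q}`. -/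
theorem stmt_5 (p e : ℕ) [Fact p.Prime] (he : 1 ≤ e) [Group (Qt p e)]
    (hmul : ∀ a b : Qt p e, (a * b).val = Qmul p e a.val b.val) :
    (∀ x : Qt p e, x ∈ commutator (Qt p e) ↔ x.val.1 = 1) ∧
    IsCyclic (Qt p e ⧸ commutator (Qt p e)) ∧
    Nat.card (Qt p e ⧸ commutator (Qt p e)) = p ^ e + 1 ∧
    ∃ φ : Qt p e →* AlgebraicClosure (ZMod p),
      (∀ x : Qt p e, φ x = x.val.1) ∧
      (∀ x : Qt p e, φ x = 1 ↔ x ∈ commutator (Qt p e)) ∧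
      (∀ a : AlgebraicClosure (ZMod p), a ^ (p ^ e + 1) = 1 → ∃ x : Qt p e, φ x = a) := by
  have hK : ∀ x : Qt p e, Qhom hmul x = x.val.1 := fun _ => rfl
  have hcomm : ∀ x : Qt p e, x ∈ commutator (Qt p e) ↔ x.val.1 = 1 := by
    intro x
    refine ⟨fun hx => ?_, Q_kernel hmul he x⟩
    have h := Abelianization.commutator_subset_ker (Qhom hmul).toHomUnits hx
    have h2 := congrArg Units.val (MonoidHom.mem_ker.1 h)
    simpa [hK] using h2
  have := neZero_card p e he
  let ψ : Qt p e →* rootsOfUnity (p ^ e + 1) (AlgebraicClosure (ZMod p)) :=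
    (Qhom hmul).toHomUnits.codRestrict _ (fun x => by
      rw [mem_rootsOfUnity']
      simpa [hK] using x.2.1)
  have hψ : ∀ x, ((ψ x : (AlgebraicClosure (ZMod p))ˣ) : AlgebraicClosure (ZMod p)) = x.val.1 :=
    fun _ => rfl
  have hex : ∀ a : AlgebraicClosure (ZMod p), a ^ (p ^ e + 1) = 1 →
      ∃ x : Qt p e, x.val.1 = a := by
    intro a ha
    have hp : p.Prime := Fact.out
    obtain ⟨g, hg, -⟩ := Q_exists (e := e) a 0 ha (by simp [hp.ne_zero])
    exact ⟨g, hg⟩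
  have hsurj : Function.Surjective ψ := by
    intro a
    obtain ⟨g, hg⟩ := hex _ ((mem_rootsOfUnity' _ _).1 a.2)
    exact ⟨g, Subtype.ext (Units.ext ((hψ g).trans hg))⟩
  have hker : commutator (Qt p e) = ψ.ker := by
    ext x
    rw [hcomm, MonoidHom.mem_ker, Subtype.ext_iff, Units.ext_iff, hψ]
    rfl
  let E := (QuotientGroup.quotientMulEquivOfEq hker).trans
    (QuotientGroup.quotientKerEquivOfSurjective ψ hsurj)
  refine ⟨hcomm, ?_, ?_, Qhom hmul, hK, fun x => by rw [hK, hcomm], hex⟩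
  · exact isCyclic_of_surjective E.symm E.symm.surjective
  · rw [Nat.card_congr E.toEquiv]
    exact HasEnoughRootsOfUnity.natCard_rootsOfUnity _ _
end

section
/- Let e ≥ 1, let k̄ be an algebraic closure of F_2, and let b₀ be an element of the subfield F_{2^{2e}} of k̄ with Tr_{F_{2^{2e}}/F_2}(b₀) = 1. Define c₀ = b₀^{2^e} + Σ_{0 ≤ i < j ≤ e−1} b₀^{2^{e+i} + 2^j}. Then c₀² + c₀ = b₀^{2^e + 1}. -/
theorem aux_shift {R : Type*} [CommRing R] (x y : ℕ → R) (n : ℕ) :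
    (∑ j ∈ Finset.range n, ∑ i ∈ Finset.range j, y (i + 1) * x (j + 1))
      + y 0 * (∑ j ∈ Finset.range n, x j) + y 0 * x n - y 0 * x 0
    = (∑ j ∈ Finset.range n, ∑ i ∈ Finset.range j, y i * x j)
      + x n * ∑ i ∈ Finset.range n, y i := by
  induction n with
  | zero => simp
  | succ n ih =>
    have h : ∑ i ∈ Finset.range n, y (i + 1) * x (n + 1)
        = (∑ i ∈ Finset.range n, y i + y n - y 0) * x (n + 1) := by
      rw [← Finset.sum_mul, ← Finset.sum_range_succ, Finset.sum_range_succ']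
      ring
    have h2 : ∑ i ∈ Finset.range n, y i * x n = (∑ i ∈ Finset.range n, y i) * x n := by
      rw [Finset.sum_mul]
    simp only [Finset.sum_range_succ _ n]
    rw [h, h2]
    linear_combination ih


/-- **The explicit solution `c₀` of `c² + c = b₀^(2^e + 1)`.**
Let `k̄` be an algebraic closure of `𝔽₂` and let `b₀` lie in the subfield `𝔽_{2^{2e}}`
(`b₀^(2^(2e)) = b₀`) with trace `1` to `𝔽₂`.  Set
`c₀ = b₀^(2^e) + Σ_{0 ≤ i < j ≤ e−1} b₀^(2^(e+i) + 2^j)`.  Then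
`c₀² + c₀ = b₀^(2^e + 1)`. -/
theorem stmt_6 (e : ℕ) (he : 1 ≤ e) (b₀ : AlgebraicClosure (ZMod 2))
    (hb₀ : b₀ ^ 2 ^ (2 * e) = b₀)
    (htr : (∑ i ∈ Finset.range (2 * e), b₀ ^ 2 ^ i) = 1) :
    (b₀ ^ 2 ^ e + ∑ j ∈ Finset.range e, ∑ i ∈ Finset.range j, b₀ ^ (2 ^ (e + i) + 2 ^ j)) ^ 2 +
      (b₀ ^ 2 ^ e + ∑ j ∈ Finset.range e, ∑ i ∈ Finset.range j, b₀ ^ (2 ^ (e + i) + 2 ^ j)) =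
        b₀ ^ (2 ^ e + 1) := by
  have h2 : (2 : AlgebraicClosure (ZMod 2)) = 0 := by
    exact_mod_cast CharP.cast_eq_zero (AlgebraicClosure (ZMod 2)) 2
  have key := aux_shift (fun j => b₀ ^ 2 ^ j) (fun i => b₀ ^ 2 ^ (e + i)) e
  have hS : (∑ j ∈ Finset.range e, ∑ i ∈ Finset.range j, b₀ ^ (2 ^ (e + i) + 2 ^ j)) ^ 2
      = ∑ j ∈ Finset.range e, ∑ i ∈ Finset.range j,
        b₀ ^ 2 ^ (e + (i + 1)) * b₀ ^ 2 ^ (j + 1) := by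
    rw [sum_pow_char 2]
    refine Finset.sum_congr rfl fun j _ => ?_
    rw [sum_pow_char 2]
    refine Finset.sum_congr rfl fun i _ => ?_
    rw [← pow_mul, ← pow_add]
    congr 1
    ring
  have hT : (∑ j ∈ Finset.range e, ∑ i ∈ Finset.range j, b₀ ^ (2 ^ (e + i) + 2 ^ j))
      = ∑ j ∈ Finset.range e, ∑ i ∈ Finset.range j, b₀ ^ 2 ^ (e + i) * b₀ ^ 2 ^ j := by
    simp only [pow_add b₀]
  rw [two_mul, Finset.sum_range_add] at htr
  simp only [add_zero, pow_zero, pow_one] at key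
  rw [← hS, ← hT] at key
  rw [pow_add b₀ (2 ^ e) 1, pow_one]
  generalize (∑ j ∈ Finset.range e, ∑ i ∈ Finset.range j, b₀ ^ (2 ^ (e + i) + 2 ^ j)) = S at *
  generalize (∑ i ∈ Finset.range e, b₀ ^ 2 ^ (e + i)) = Y at *
  generalize (∑ i ∈ Finset.range e, b₀ ^ 2 ^ i) = X at *
  generalize b₀ ^ 2 ^ e = y at *
  linear_combination key - y * htr + (y * S + S + y * Y) * h2
end

section
/- Let e ≥ 1, let k̄ be an algebraic closure of F_2, and let b₀ ∈ F_{2^{2e}} ⊂ k̄ satisfy Tr_{F_{2^{2e}}/F_2}(b₀) = 1. If y₀ ∈ k̄ satisfies y₀² + y₀ = b₀^{2^e}, then y₀^{2^e+1} + Σ_{i=0}^{e−1} (b₀ y₀)^{2^i} = b₀^{2^e} + Σ_{0 ≤ i < j ≤ e−1} b₀^{2^{e+i} + 2^j}. -/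
/-- **Evaluation of `y₀^(2^e+1) + Σ_{i<e} (b₀ y₀)^(2^i)`.**
Let `k̄` be an algebraic closure of `𝔽₂` and let `b₀` lie in the subfield `𝔽_{2^{2e}}`
(`b₀^(2^(2e)) = b₀`) with trace `1` to `𝔽₂`.  If `y₀ ∈ k̄` satisfies
`y₀² + y₀ = b₀^(2^e)`, then
`y₀^(2^e+1) + Σ_{i=0}^{e−1} (b₀ y₀)^(2^i) = b₀^(2^e) + Σ_{0 ≤ i < j ≤ e−1} b₀^(2^(e+i)+2^j)`. -/
theorem stmt_7 (e : ℕ) (he : 1 ≤ e) (b₀ y₀ : AlgebraicClosure (ZMod 2))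
    (hb₀ : b₀ ^ 2 ^ (2 * e) = b₀)
    (htr : (∑ i ∈ Finset.range (2 * e), b₀ ^ 2 ^ i) = 1)
    (hy₀ : y₀ ^ 2 + y₀ = b₀ ^ 2 ^ e) :
    y₀ ^ (2 ^ e + 1) + (∑ i ∈ Finset.range e, (b₀ * y₀) ^ 2 ^ i) =
      b₀ ^ 2 ^ e + ∑ j ∈ Finset.range e, ∑ i ∈ Finset.range j, b₀ ^ (2 ^ (e + i) + 2 ^ j) := by
  have : CharP (AlgebraicClosure (ZMod 2)) 2 := inferInstance
  have h2 : (2 : AlgebraicClosure (ZMod 2)) = 0 := CharTwo.two_eq_zero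
  have hy : ∀ i : ℕ, y₀ ^ 2 ^ i = y₀ + ∑ k ∈ Finset.range i, b₀ ^ 2 ^ (e + k) := by
    intro i
    induction i with
    | zero => simp
    | succ n ih =>
      have h1 : y₀ ^ 2 = y₀ + b₀ ^ 2 ^ e := by linear_combination hy₀ - y₀ * h2
      rw [pow_succ', pow_mul, h1, add_pow_char_pow, ih, Finset.sum_range_succ, ← pow_mul,
        ← pow_add, add_assoc]
  have hs : ∑ i ∈ Finset.range e, (b₀ * y₀) ^ 2 ^ i
      = (∑ i ∈ Finset.range e, b₀ ^ 2 ^ i) * y₀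
        + ∑ j ∈ Finset.range e, ∑ i ∈ Finset.range j, b₀ ^ (2 ^ (e + i) + 2 ^ j) := by
    rw [Finset.sum_mul, ← Finset.sum_add_distrib]
    refine Finset.sum_congr rfl fun j _ => ?_
    rw [mul_pow, hy j, mul_add, Finset.mul_sum]
    congr 1
    refine Finset.sum_congr rfl fun i _ => ?_
    rw [pow_add b₀, mul_comm]
  rw [two_mul, Finset.sum_range_add] at htr
  rw [hs, pow_succ, hy e]
  linear_combination hy₀ + y₀ * htr
end

section
/- Let p be an odd prime, e ≥ 1, and let e₀ be the unique power of 2 such that e/e₀ is an odd integer (i.e. e₀ = 2^{v₂(e)}). Let F be the finite field with p^{2e₀} elements and let ψ : F_p → ℂ^× be a non-trivial additive character. Then Σ_{b ∈ F} ψ( Tr_{F/F_p}( b^{p^e + 1} ) ) = −p^{e₀}. -/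
theorem aux_trace (p : ℕ) [Fact p.Prime] (F : Type) [Field F] [Fintype F] [Algebra (ZMod p) F]
    (n : ℕ) (x : F) :
    Algebra.trace (ZMod p) F (x ^ (p ^ n)) = Algebra.trace (ZMod p) F x := by
  induction n with
  | zero => simp
  | succ n ih =>
    rw [pow_succ, pow_mul, ← ih]
    have := Algebra.trace_eq_of_algEquiv
      (FiniteField.frobeniusAlgEquivOfAlgebraic (ZMod p) F) (x ^ p ^ n)
    simpa [ZMod.card] using this

theorem aux_sum_add {F : Type} [Field F] [Fintype F] [DecidableEq F] (q : ℕ)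
    (hadd : ∀ x y : F, (x + y) ^ q = x ^ q + y ^ q) (χ : AddChar F ℂ) (k : F) (hk : k ^ q = k)
    (hχ : χ k ≠ 1) :
    ∑ y ∈ Finset.univ.filter (fun y : F => y ^ q = y), χ y = 0 := by
  have h : ∑ y ∈ Finset.univ.filter (fun y : F => y ^ q = y), χ y
      = ∑ y ∈ Finset.univ.filter (fun y : F => y ^ q = y), χ (k + y) := by
    symm
    refine Finset.sum_bijective (fun y => k + y) (AddGroup.addLeft_bijective k) ?_ ?_
    · intro y
      simp [hadd, hk]
    · intros; rfl
  simp only [AddChar.map_add_eq_mul, ← Finset.mul_sum] at h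
  have h2 : (χ k - 1) * ∑ y ∈ Finset.univ.filter (fun y : F => y ^ q = y), χ y = 0 := by
    rw [sub_mul, ← h]; ring
  exact (mul_eq_zero.mp h2).resolve_left (sub_ne_zero.mpr hχ)

theorem aux_fiber {F : Type} [Field F] [Fintype F] [DecidableEq F] (q : ℕ) (hq : 2 ≤ q)
    (hF : Fintype.card F = q ^ 2) (f : F → ℂ) :
    ∑ b ∈ Finset.univ.erase (0 : F), f (b ^ (q + 1))
      = (q + 1) * ∑ y ∈ (Finset.univ.filter (fun y : F => y ^ q = y)).erase 0, f y := by
  set K := (Finset.univ.filter (fun y : F => y ^ q = y)).erase 0 with hK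
  have hmaps : ∀ b ∈ Finset.univ.erase (0 : F), b ^ (q + 1) ∈ K := by
    intro b hb
    have hb0 : b ≠ 0 := by simpa using hb
    simp only [hK, Finset.mem_erase, Finset.mem_filter, Finset.mem_univ, true_and]
    refine ⟨pow_ne_zero _ hb0, ?_⟩
    have h1 : b ^ (q ^ 2) = b := by rw [← hF]; exact FiniteField.pow_card b
    calc (b ^ (q + 1)) ^ q = b ^ (q ^ 2) * b ^ q := by ring
      _ = _ := by rw [h1]; ring
  have hKcard : K.card ≤ q - 1 := by
    calc K.card ≤ (Polynomial.nthRoots (q - 1) (1 : F)).toFinset.card := by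
          apply Finset.card_le_card
          intro y hy
          simp only [hK, Finset.mem_erase, Finset.mem_filter, Finset.mem_univ, true_and] at hy
          rw [Multiset.mem_toFinset, Polynomial.mem_nthRoots (by omega)]
          apply mul_right_cancel₀ hy.1
          rw [← pow_succ, Nat.sub_add_cancel (by omega), hy.2, one_mul]
      _ ≤ _ := (Multiset.toFinset_card_le _).trans (Polynomial.card_nthRoots _ _)
  have hfib : ∀ y ∈ K, ((Finset.univ.erase (0 : F)).filter (fun b => b ^ (q + 1) = y)).card
      ≤ q + 1 := by
    intro y _
    calc _ ≤ (Polynomial.nthRoots (q + 1) y).toFinset.card := by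
          apply Finset.card_le_card
          intro b hb
          rw [Multiset.mem_toFinset, Polynomial.mem_nthRoots (by omega)]
          exact (Finset.mem_filter.mp hb).2
      _ ≤ _ := (Multiset.toFinset_card_le _).trans (Polynomial.card_nthRoots _ _)
  have htot := Finset.card_eq_sum_card_fiberwise hmaps
  rw [Finset.card_erase_of_mem (Finset.mem_univ _), Finset.card_univ, hF] at htot
  have hle := Finset.sum_le_sum hfib
  have heq : ∑ y ∈ K, ((Finset.univ.erase (0 : F)).filter (fun b => b ^ (q + 1) = y)).card
      = ∑ y ∈ K, (q + 1) := by
    apply le_antisymm hle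
    rw [← htot, Finset.sum_const, smul_eq_mul]
    obtain ⟨r, rfl⟩ : ∃ r, q = r + 1 := ⟨q - 1, by omega⟩
    have : (r + 1) ^ 2 - 1 = r * (r + 1 + 1) := by
      apply Nat.sub_eq_of_eq_add; ring
    rw [this]
    exact Nat.mul_le_mul_right _ (by simpa using hKcard)
  have hall := (Finset.sum_eq_sum_iff_of_le hfib).mp heq
  rw [← Finset.sum_fiberwise_of_maps_to hmaps, Finset.mul_sum]
  refine Finset.sum_congr rfl fun y hy => ?_
  have : ∀ b ∈ (Finset.univ.erase (0 : F)).filter (fun b => b ^ (q + 1) = y),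
      f (b ^ (q + 1)) = f y := fun b hb => by rw [(Finset.mem_filter.mp hb).2]
  rw [Finset.sum_congr rfl this, Finset.sum_const, hall y hy, nsmul_eq_mul]
  push_cast
  rfl



/-- **A Gauss-sum evaluation: `Σ_{b ∈ 𝔽_{p^{2e₀}}} ψ(Tr(b^(p^e+1))) = −p^{e₀}`.**
Here `p` is an odd prime, `e ≥ 1`, `e₀ = 2^(v₂ e)` is the 2-part of `e`, `F` is the
finite field with `p^(2e₀)` elements, `Tr` is the field trace to `𝔽_p`, and
`ψ : 𝔽_p → ℂˣ` is a non-trivial additive character. -/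
theorem stmt_8 (p e e₀ : ℕ) (hp : p.Prime) (hp2 : Odd p) (he : 1 ≤ e)
    (he₀ : e₀ = 2 ^ padicValNat 2 e)
    (F : Type) [Field F] [Fintype F] [Algebra (ZMod p) F]
    (hF : Fintype.card F = p ^ (2 * e₀))
    (ψ : AddChar (ZMod p) ℂ) (hψ : ψ ≠ 1) :
    ∑ b : F, ψ (Algebra.trace (ZMod p) F (b ^ (p ^ e + 1))) = -(p : ℂ) ^ e₀ := by
  classical
  have : Fact p.Prime := ⟨hp⟩
  have : CharP F p := charP_of_injective_algebraMap (algebraMap (ZMod p) F).injective p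
  have he₀pos : 0 < e₀ := by rw [he₀]; positivity
  set q := p ^ e₀ with hqdef
  have hF2 : Fintype.card F = q ^ 2 := by rw [hF, hqdef]; ring
  have hq : 2 ≤ q := hp.two_le.trans (Nat.le_self_pow (by omega) p)
  have hadd : ∀ x y : F, (x + y) ^ q = x ^ q + y ^ q := fun x y => add_pow_char_pow x y p e₀
  have hqq : ∀ b : F, (b ^ q) ^ q = b := fun b => by
    rw [← pow_mul, ← sq, ← hF2]; exact FiniteField.pow_card b
  obtain ⟨m, hm⟩ : ∃ m, e = e₀ * (2 * m + 1) := by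
    obtain ⟨c, hc⟩ : e₀ ∣ e := by rw [he₀]; exact pow_padicValNat_dvd
    have hodd : ¬ 2 ∣ c := by
      rintro ⟨d, rfl⟩
      have : 2 ^ (padicValNat 2 e + 1) ∣ e := ⟨d, by rw [pow_succ, ← he₀, mul_assoc]; exact hc⟩
      exact pow_succ_padicValNat_not_dvd (by omega) this
    exact ⟨c / 2, by rw [hc]; congr 1; omega⟩
  have hpow : ∀ b : F, b ^ (p ^ e) = b ^ q := by
    intro b
    have hb : p ^ e = q ^ (2 * m + 1) := by rw [hm, hqdef, pow_mul]
    rw [hb]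
    clear hb hm
    induction m with
    | zero => simp
    | succ m ih =>
      rw [show q ^ (2 * (m + 1) + 1) = q ^ (2 * m + 1) * (q * q) by ring, pow_mul, ih, pow_mul, hqq]
  have h2 : (2 : ZMod p) ≠ 0 := by
    intro h
    have : (p : ℕ) ∣ 2 := (ZMod.natCast_eq_zero_iff 2 p).mp (by exact_mod_cast h)
    have h3 := (Nat.prime_dvd_prime_iff_eq hp Nat.prime_two).mp this
    subst h3
    exact absurd hp2 (by decide)
  set χ : AddChar F ℂ := ψ.compAddMonoidHom (Algebra.trace (ZMod p) F).toAddMonoidHom with hχ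
  have hχa : ∀ x, χ x = ψ (Algebra.trace (ZMod p) F x) := fun x => rfl
  obtain ⟨k, hk, hk1⟩ : ∃ k : F, k ^ q = k ∧ χ k ≠ 1 := by
    obtain ⟨a, ha⟩ := (AddChar.ne_one_iff).mp hψ
    obtain ⟨x, hx⟩ := Algebra.trace_surjective (ZMod p) F (a / 2)
    refine ⟨x + x ^ q, by rw [hadd, hqq, add_comm], ?_⟩
    rw [hχa, map_add, hqdef, aux_trace, hx]
    convert ha using 2
    congr 1
    field_simp
    ring
  have hsum := aux_sum_add q hadd χ k hk hk1
  have hfib := aux_fiber q hq hF2 (fun x => χ x)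
  rw [← Finset.add_sum_erase _ _ (show (0 : F) ∈ Finset.univ.filter (fun y : F => y ^ q = y) by
    simp; omega), AddChar.map_zero_eq_one] at hsum
  have hK := eq_neg_of_add_eq_zero_right hsum
  rw [hK] at hfib
  have : ∀ b : F, ψ (Algebra.trace (ZMod p) F (b ^ (p ^ e + 1))) = χ (b ^ (q + 1)) := by
    intro b; rw [hχa, pow_succ, hpow, ← pow_succ]
  simp only [this]
  rw [← Finset.add_sum_erase _ _ (Finset.mem_univ (0 : F)), hfib]
  rw [zero_pow (by omega), AddChar.map_zero_eq_one, hqdef]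
  push_cast
  ring
end

section
/- Let p be an odd prime, e ≥ 1, and let e₀ = 2^{v₂(e)} be the unique power of 2 such that e/e₀ is odd. Then gcd(p^e + 1, p^{2e₀} − 1) = p^{e₀} + 1. -/
/-- **`gcd(p^e + 1, p^(2e₀) − 1) = p^(e₀) + 1`** for an odd prime `p`, `e ≥ 1`, and
`e₀ = 2^(v₂ e)` the largest power of `2` such that `e/e₀` is odd. -/
theorem stmt_9 (p e e₀ : ℕ) (hp : p.Prime) (hp2 : Odd p) (he : 1 ≤ e)
    (he₀ : e₀ = 2 ^ padicValNat 2 e) :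
    Nat.gcd (p ^ e + 1) (p ^ (2 * e₀) - 1) = p ^ e₀ + 1 := by
  have hd : e₀ ∣ e := he₀ ▸ pow_padicValNat_dvd
  obtain ⟨m, hm⟩ := hd
  have hodd : Odd m := by
    rw [← Nat.not_even_iff_odd]
    intro hev
    obtain ⟨t, rfl⟩ := hev.two_dvd
    apply pow_succ_padicValNat_not_dvd (p := 2) (n := e) (by omega)
    refine ⟨t, ?_⟩
    rw [pow_succ, ← he₀, hm]
    ring
  obtain ⟨k, rfl⟩ := hodd
  have hq : 1 ≤ p ^ e₀ := Nat.one_le_pow _ _ hp.pos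
  have h1 : p ^ e = (p ^ e₀) ^ (2 * k + 1) := by rw [← pow_mul, hm]
  have h2 : p ^ (2 * e₀) = (p ^ e₀) ^ 2 := by rw [← pow_mul, mul_comm]
  rw [h1, h2]
  generalize p ^ e₀ = q at hq
  have h3 : q ^ 2 - 1 ∣ (q ^ 2) ^ k - 1 := by
    simpa using Nat.sub_dvd_pow_sub_pow (q ^ 2) 1 k
  obtain ⟨c, hc⟩ := h3
  have h4 : (q ^ 2) ^ k = (q ^ 2 - 1) * c + 1 := by
    have : 1 ≤ (q ^ 2) ^ k := Nat.one_le_pow _ _ (by positivity)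
    omega
  have h5 : q ^ (2 * k + 1) + 1 = (q + 1) + (q ^ 2 - 1) * (c * q) := by
    rw [pow_succ, pow_mul, h4]
    ring
  rw [h5, Nat.gcd_add_mul_left_left]
  apply Nat.gcd_eq_left
  exact ⟨q - 1, by simpa using Nat.sq_sub_sq q 1⟩
end

section
/- Let p be an odd prime, let e₀ and e be positive integers with e₀ dividing e, and let k̄ be an algebraic closure of F_p. Let r ∈ k̄ satisfy r^{p^{2e₀}} = r and r^{p^e + 1} = −1. Then the set V = { b ∈ k̄ : b^{p^e} = r b } is an F_p-subspace of k̄ of cardinality p^e, the map φ : b ↦ b^{p^{2e₀}} − b sends V into V, and φ : V → V is bijective. -/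
/-- **The set `V = {b : b^(p^e) = r b}` is an `𝔽_p`-subspace of cardinality `p^e`, and
`b ↦ b^(p^(2e₀)) − b` is a bijection of `V` onto itself.**
Here `p` is an odd prime, `e₀ ∣ e` are positive integers, `k̄` is an algebraic closure
of `𝔽_p`, and `r ∈ k̄` satisfies `r^(p^(2e₀)) = r` (i.e. `r ∈ 𝔽_{p^{2e₀}}`) and
`r^(p^e + 1) = −1`. -/
theorem stmt_12 (p e e₀ : ℕ) [Fact p.Prime] (hp2 : Odd p)
    (he₀ : 1 ≤ e₀) (he : 1 ≤ e) (hdvd : e₀ ∣ e)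
    (r : AlgebraicClosure (ZMod p))
    (hr1 : r ^ p ^ (2 * e₀) = r) (hr2 : r ^ (p ^ e + 1) = -1) :
    (∃ S : Submodule (ZMod p) (AlgebraicClosure (ZMod p)),
        (S : Set (AlgebraicClosure (ZMod p))) = {b | b ^ p ^ e = r * b}) ∧
      Nat.card {b : AlgebraicClosure (ZMod p) | b ^ p ^ e = r * b} = p ^ e ∧
      Set.MapsTo (fun b => b ^ p ^ (2 * e₀) - b)
        {b : AlgebraicClosure (ZMod p) | b ^ p ^ e = r * b}
        {b : AlgebraicClosure (ZMod p) | b ^ p ^ e = r * b} ∧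
      Set.BijOn (fun b => b ^ p ^ (2 * e₀) - b)
        {b : AlgebraicClosure (ZMod p) | b ^ p ^ e = r * b}
        {b : AlgebraicClosure (ZMod p) | b ^ p ^ e = r * b} := by
  have hpp : p.Prime := Fact.out
  have : CharP (AlgebraicClosure (ZMod p)) p := charP_of_injective_algebraMap (algebraMap (ZMod p) (AlgebraicClosure (ZMod p))).injective p
  have : ExpChar (AlgebraicClosure (ZMod p)) p := ExpChar.prime hpp
  have h2 : (2 : (AlgebraicClosure (ZMod p))) ≠ 0 := by
    intro h
    have h' : ((2 : ℕ) : (AlgebraicClosure (ZMod p))) = 0 := by exact_mod_cast h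
    rw [CharP.cast_eq_zero_iff (AlgebraicClosure (ZMod p)) p] at h'
    have := (Nat.prime_dvd_prime_iff_eq hpp Nat.prime_two).1 h'
    subst this
    exact absurd hp2 (by decide)
  have hr0 : r ≠ 0 := by
    rintro rfl
    rw [zero_pow (by omega)] at hr2
    exact one_ne_zero (neg_eq_zero.1 hr2.symm)
  have hq : 1 < p ^ e := Nat.one_lt_pow (by omega) hpp.one_lt
  have hpe0 : ((p ^ e : ℕ) : (AlgebraicClosure (ZMod p))) = 0 := by
    rw [CharP.cast_eq_zero_iff (AlgebraicClosure (ZMod p)) p]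
    exact dvd_pow_self p (by omega)
  have hcard : Nat.card {b : (AlgebraicClosure (ZMod p)) | b ^ p ^ e = r * b} = p ^ e := by
    let f : Polynomial (AlgebraicClosure (ZMod p)) := Polynomial.X ^ (p ^ e) - Polynomial.C r * Polynomial.X
    have hdeg : f.natDegree = p ^ e := by
      rw [Polynomial.natDegree_sub_eq_left_of_natDegree_lt]
      · simp
      · rw [Polynomial.natDegree_C_mul_X _ hr0]; simpa using hq
    have hf0 : f ≠ 0 := by
      intro h
      rw [h] at hdeg
      simp at hdeg
      omega
    have hsep : f.Separable := by
      have hd : Polynomial.derivative f = Polynomial.C (-r) := by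
        simp only [f, Polynomial.derivative_sub, Polynomial.derivative_X_pow,
          Polynomial.derivative_C_mul, Polynomial.derivative_X, hpe0]
        simp
      rw [Polynomial.Separable, hd]
      refine ⟨0, Polynomial.C (-r)⁻¹, ?_⟩
      rw [zero_mul, zero_add, ← Polynomial.C_mul, inv_mul_cancel₀ (neg_ne_zero.2 hr0),
        Polynomial.C_1]
    have h1 : Fintype.card (f.rootSet (AlgebraicClosure (ZMod p))) = f.natDegree :=
      Polynomial.card_rootSet_eq_natDegree hsep (IsAlgClosed.splits _)
    have h3 : {b : (AlgebraicClosure (ZMod p)) | b ^ p ^ e = r * b} = f.rootSet (AlgebraicClosure (ZMod p)) := by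
      ext b
      rw [Polynomial.mem_rootSet]
      simp [f, sub_eq_zero, hf0]
    rw [h3, Nat.card_eq_fintype_card, h1, hdeg]
  have hmaps : Set.MapsTo (fun b => b ^ p ^ (2 * e₀) - b)
        {b : (AlgebraicClosure (ZMod p)) | b ^ p ^ e = r * b} {b : (AlgebraicClosure (ZMod p)) | b ^ p ^ e = r * b} := by
    intro b hb
    simp only [Set.mem_ofPred_eq] at hb ⊢
    rw [sub_pow_expChar_pow, ← pow_mul, mul_comm (p ^ (2 * e₀)), pow_mul, hb, mul_pow, hr1,
      mul_sub]
  have hinj : Set.InjOn (fun b => b ^ p ^ (2 * e₀) - b) {b : (AlgebraicClosure (ZMod p)) | b ^ p ^ e = r * b} := by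
    intro b hb c hc hbc
    simp only [Set.mem_ofPred_eq] at hb hc hbc
    obtain ⟨m, rfl⟩ := hdvd
    have hd : (b - c) ^ p ^ (e₀ * m) = r * (b - c) := by
      rw [sub_pow_expChar_pow, hb, hc, mul_sub]
    have hd2 : (b - c) ^ p ^ (2 * e₀) = b - c := by
      rw [sub_pow_expChar_pow]; linear_combination hbc
    have hall : ∀ n : ℕ, (b - c) ^ p ^ (2 * e₀ * n) = b - c := by
      intro n
      induction n with
      | zero => simp
      | succ n ih => rw [mul_add, mul_one, pow_add, pow_mul, ih, hd2]
    have h3 : (b - c) ^ p ^ (2 * e₀ * m) = -(b - c) := by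
      have : 2 * e₀ * m = e₀ * m + e₀ * m := by ring
      rw [this, pow_add, pow_mul, hd, mul_pow, hd, ← mul_assoc, ← pow_succ, hr2]
      ring
    rw [hall] at h3
    have h4 : 2 * (b - c) = 0 := by linear_combination h3
    exact sub_eq_zero.1 ((mul_eq_zero.1 h4).resolve_left h2)
  have hfin : {b : (AlgebraicClosure (ZMod p)) | b ^ p ^ e = r * b}.Finite :=
    Set.finite_coe_iff.1 (Nat.finite_of_card_ne_zero (by rw [hcard]; omega))
  refine ⟨⟨AddSubgroup.toZModSubmodule p
    { carrier := {b : (AlgebraicClosure (ZMod p)) | b ^ p ^ e = r * b}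
      zero_mem' := by
        simp only [Set.mem_ofPred_eq]
        rw [zero_pow (by omega), mul_zero]
      add_mem' := by
        intro a b ha hb
        simp only [Set.mem_ofPred_eq] at *
        rw [add_pow_expChar_pow, ha, hb, mul_add]
      neg_mem' := by
        intro a ha
        simp only [Set.mem_ofPred_eq] at *
        rw [(hp2.pow).neg_pow, ha, mul_neg] }, ?_⟩, hcard, hmaps, hmaps, hinj, ?_⟩
  · rfl
  · have := Set.eq_of_subset_of_ncard_le hmaps.image_subset
      (Set.ncard_image_of_injOn hinj).ge hfin
    exact this.ge
end

section
/- Let F be a field of odd characteristic p, let e ≥ 1, and let r ∈ F satisfy r^{p^e + 1} = −1. Suppose β, γ ∈ F satisfy γ^p − γ = β^{p^e + 1}. Set δ = β^{p^e} − rβ and θ = γ + (1/2) Σ_{i=0}^{e−1} (r β²)^{p^i}. Then θ^p − θ = −δ² / (2r). -/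
/-- **An Artin–Schreier identity in odd characteristic.**
Let `F` be a field of odd characteristic `p`, `e ≥ 1`, and `r ∈ F` with
`r^(p^e + 1) = −1`.  Suppose `γ^p − γ = β^(p^e + 1)`, and set `δ = β^(p^e) − rβ` and
`θ = γ + (1/2) Σ_{i=0}^{e−1} (rβ²)^(p^i)`.  Then `θ^p − θ = −δ²/(2r)`. -/
theorem stmt_13 (p e : ℕ) (hp : p.Prime) (hp2 : Odd p) (he : 1 ≤ e)
    (F : Type) [Field F] [CharP F p] (r β γ : F)
    (hr : r ^ (p ^ e + 1) = -1) (hγ : γ ^ p - γ = β ^ (p ^ e + 1)) :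
    (γ + (1 / 2 : F) * ∑ i ∈ Finset.range e, (r * β ^ 2) ^ p ^ i) ^ p -
        (γ + (1 / 2 : F) * ∑ i ∈ Finset.range e, (r * β ^ 2) ^ p ^ i) =
      -(β ^ p ^ e - r * β) ^ 2 / (2 * r) := by
  haveI : Fact p.Prime := ⟨hp⟩
  have h2 : (2 : F) ≠ 0 := by
    intro h
    have h' : ((2 : ℕ) : F) = 0 := by exact_mod_cast h
    have hd : p ∣ 2 := (CharP.cast_eq_zero_iff F p 2).1 h'
    have := Nat.le_of_dvd (by norm_num) hd
    have := hp.two_le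
    obtain ⟨k, hk⟩ := hp2
    omega
  have hr0 : r ≠ 0 := by
    rintro rfl
    simp at hr
  have hhalf : (1 / 2 : F) ^ p = 1 / 2 := by
    have h : (2 : F) ^ p = 2 := by
      have := map_ofNat (frobenius F p) 2
      simpa [frobenius_def] using this
    rw [div_pow, one_pow, h]
  have htel : ∀ n : ℕ, ∀ x : F, (∑ i ∈ Finset.range n, x ^ p ^ i) ^ p
      - ∑ i ∈ Finset.range n, x ^ p ^ i = x ^ p ^ n - x := by
    intro n x
    rw [sum_pow_char p]
    simp only [← pow_mul, ← pow_succ]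
    rw [← Finset.sum_sub_distrib, Finset.sum_range_sub (fun i => x ^ p ^ i)]
    simp
  have ht := htel e (r * β ^ 2)
  rw [add_pow_char, mul_pow, hhalf]
  rw [mul_pow, ← pow_mul, mul_comm 2 (p ^ e), pow_mul] at ht
  rw [pow_succ] at hr hγ
  generalize (∑ i ∈ Finset.range e, (r * β ^ 2) ^ p ^ i) = S at *
  generalize β ^ p ^ e = B at *
  generalize r ^ p ^ e = R at *
  rw [eq_div_iff (mul_ne_zero h2 hr0)]
  field_simp
  linear_combination (2 * r) * hγ + r * ht + B ^ 2 * hr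
end

section
/- Let K be a field, let q ≥ 2 be an integer, let u, v ∈ K, and suppose the polynomial f(X) = X^q − uX − v is irreducible and separable over K. Let L = K(δ) where δ is a root of f, so [L : K] = q. Then Tr_{L/K}(δ^i) = 0 for every integer i with 1 ≤ i ≤ q − 2, and Tr_{L/K}(δ^{q−1}) = (q − 1)·u. -/
/-- **Traces of powers of a root of `X^q − uX − v`.**
Let `K` be a field, `q ≥ 2`, `u, v ∈ K`, and suppose `f = X^q − uX − v` is irreducible
and separable over `K`.  Let `L = K(δ)` where `δ` is a root of `f`, so `[L : K] = q`.
Then `Tr_{L/K}(δ^i) = 0` for `1 ≤ i ≤ q − 2` and `Tr_{L/K}(δ^(q−1)) = (q−1)·u`. -/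
theorem stmt_16 (K L : Type) [Field K] [Field L] [Algebra K L] [FiniteDimensional K L]
    (q : ℕ) (hq : 2 ≤ q) (u v : K) (δ : L) (f : Polynomial K)
    (hf : f = Polynomial.X ^ q - Polynomial.C u * Polynomial.X - Polynomial.C v)
    (hirr : Irreducible f) (hsep : f.Separable)
    (hroot : Polynomial.aeval δ f = 0)
    (hgen : Algebra.adjoin K {δ} = ⊤) :
    Module.finrank K L = q ∧
      (∀ i : ℕ, 1 ≤ i → i ≤ q - 2 → Algebra.trace K L (δ ^ i) = 0) ∧
      Algebra.trace K L (δ ^ (q - 1)) = ((q - 1 : ℕ) : K) * u := by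
  have hf' : f = Polynomial.X ^ q - (Polynomial.C u * Polynomial.X + Polynomial.C v) := by
    rw [hf]; ring
  have hlin : (Polynomial.C u * Polynomial.X + Polynomial.C v).degree < (q : WithBot ℕ) :=
    lt_of_le_of_lt Polynomial.degree_linear_le (by exact_mod_cast hq)
  have hmonic : f.Monic := by
    rw [hf']; exact (Polynomial.monic_X_pow q).sub_of_left (by rw [Polynomial.degree_X_pow]; exact hlin)
  have hdeg : f.natDegree = q := by
    rw [hf']
    apply Polynomial.natDegree_eq_of_degree_eq_some
    rw [Polynomial.degree_sub_eq_left_of_degree_lt] <;> simp [Polynomial.degree_X_pow, hlin]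
  have hmin : minpoly K δ = f := (minpoly.eq_of_irreducible_of_monic hirr hroot hmonic).symm
  have hrel : δ ^ q = u • δ + v • (1 : L) := by
    rw [hf] at hroot
    simp only [map_sub, map_mul, map_pow, Polynomial.aeval_X, Polynomial.aeval_C] at hroot
    rw [Algebra.smul_def, Algebra.smul_def]
    linear_combination hroot
  let pb := PowerBasis.ofAdjoinEqTop (Algebra.IsIntegral.isIntegral (R := K) δ) hgen
  have hgen' : pb.gen = δ := PowerBasis.ofAdjoinEqTop_gen _ _
  have hdim : pb.dim = q := by
    rw [← hdeg, ← hmin, ← hgen', PowerBasis.natDegree_minpoly]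
  let b : Module.Basis (Fin q) K L := pb.basis.reindex (finCongr hdim)
  have hb : ∀ j : Fin q, b j = δ ^ (j : ℕ) := by
    intro j; simp [b, hgen']
  have hrep : ∀ m (j : Fin q), m < q → b.repr (δ ^ m) j = if m = (j : ℕ) then 1 else 0 := by
    intro m j hm
    rw [← hb ⟨m, hm⟩, Module.Basis.repr_self, Finsupp.single_apply]
    simp [Fin.ext_iff]
  have hdiag : ∀ i, 1 ≤ i → i ≤ q - 1 → ∀ j : Fin q,
      b.repr (δ ^ i * δ ^ (j : ℕ)) j = if i = q - 1 ∧ (j : ℕ) ≠ 0 then u else 0 := by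
    intro i h1 h2 j
    have hj := j.2
    rw [← pow_add]
    by_cases h : i + j < q
    · rw [hrep _ _ h, if_neg (by omega), if_neg (by omega)]
    · obtain ⟨k, hk⟩ := Nat.exists_eq_add_of_le (not_lt.mp h)
      have : δ ^ (i + (j : ℕ)) = u • δ ^ (k + 1) + v • δ ^ k := by
        rw [hk, pow_add, hrel, add_mul, smul_mul_assoc, smul_mul_assoc, one_mul, pow_succ']
      rw [this, map_add, map_smul, map_smul, Finsupp.add_apply, Finsupp.smul_apply,
        Finsupp.smul_apply, hrep _ _ (by omega), hrep _ _ (by omega),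
        if_neg (show ¬ k = (j : ℕ) by omega)]
      by_cases h3 : i = q - 1
      · rw [if_pos (by omega), if_pos (by omega)]; simp
      · rw [if_neg (by omega), if_neg (by omega)]; simp
  have htr : ∀ i, 1 ≤ i → i ≤ q - 1 → Algebra.trace K L (δ ^ i) =
      ∑ j : Fin q, if i = q - 1 ∧ (j : ℕ) ≠ 0 then u else 0 := by
    intro i h1 h2
    rw [Algebra.trace_eq_matrix_trace b, Matrix.trace]
    refine Finset.sum_congr rfl fun j _ => ?_
    rw [Matrix.diag_apply, Algebra.leftMulMatrix_eq_repr_mul, hb, hdiag i h1 h2]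
  refine ⟨by rw [pb.finrank, hdim], fun i h1 h2 => ?_, ?_⟩
  · rw [htr i h1 (by omega)]
    refine Finset.sum_eq_zero fun j _ => if_neg (by omega)
  · rw [htr _ (by omega) le_rfl]
    obtain ⟨n, rfl⟩ : ∃ n, q = n + 1 := ⟨q - 1, by omega⟩
    rw [Fin.sum_univ_succ]
    simp
end

section
/- Let p be an odd prime and m ≥ 1 an integer, let F be the finite field with p^{2m} elements, let χ : F^× → {±1} be the quadratic character of F (χ(x) = 1 if x is a non-zero square, −1 otherwise), and let ψ : F_p → ℂ^× be a non-trivial additive character. Then for every r ∈ F^×: Σ_{x ∈ F} ψ( Tr_{F/F_p}( r x² ) ) = −( (−1)^{(p−1)/2} p )^{m} · χ(r). -/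
/-- Value of the quadratic character on the eigenspaces of the `Q`-power map. -/
lemma aux_char {F : Type} [Field F] [Fintype F] [DecidableEq F] (hF : ringChar F ≠ 2)
    (k : ℕ) (hk : Fintype.card F = (2 * k + 1) ^ 2) (x : F) (hx : x ≠ 0) (e : ℤ)
    (he : e = 1 ∨ e = -1) (hxe : x ^ (2 * k + 1) = (e : F) * x) :
    quadraticChar F x = e ^ (k + 1) := by
  have h1 : x ^ (2 * k) = (e : F) := by
    have : x ^ (2 * k) * x = (e : F) * x := by rw [← hxe, pow_succ]
    exact mul_right_cancel₀ hx this
  have h2 : Fintype.card F / 2 = (2 * k) * (k + 1) := by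
    rw [hk]
    have : (2 * k + 1) ^ 2 = 2 * ((2 * k) * (k + 1)) + 1 := by ring
    omega
  rw [quadraticChar_eq_pow_of_char_ne_two hF hx, h2, pow_mul, h1]
  have hne : (-1 : F) ≠ 1 := Ring.neg_one_ne_one_of_char_ne_two hF
  rcases he with rfl | rfl
  · simp
  · rcases Nat.even_or_odd (k + 1) with h | h
    · simp [h.neg_one_pow]
    · simp [h.neg_one_pow, hne]

lemma aux_main {F : Type} [Field F] [Fintype F] [DecidableEq F] (hF : ringChar F ≠ 2)
    (k : ℕ) (hk : Fintype.card F = (2 * k + 1) ^ 2) (φ : F →+* F)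
    (hφ : ∀ x, φ x = x ^ (2 * k + 1)) (Ψ : AddChar F ℂ) (hΨ : Ψ ≠ 1)
    (hinv : ∀ x, Ψ (φ x) = Ψ x) :
    gaussSum ((quadraticChar F).ringHomComp (Int.castRingHom ℂ)) Ψ
      = (-1) ^ (k + 1) * (2 * k + 1) := by
  classical
  set χ := (quadraticChar F).ringHomComp (Int.castRingHom ℂ) with hχ
  have hprim : Ψ.IsPrimitive := AddChar.IsPrimitive.of_ne_one hΨ
  have hχq : χ.IsQuadratic := (quadraticChar_isQuadratic F).comp _
  have hχ1 : χ ≠ 1 := by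
    intro h
    apply quadraticChar_ne_one hF
    exact (MulChar.ringHomComp_eq_one_iff (Int.cast_injective)).mp h
  have h2 : (2 : F) ≠ 0 := Ring.two_ne_zero hF
  have hφφ : ∀ x, φ (φ x) = x := by
    intro x
    rw [hφ, hφ, ← pow_mul, ← sq, ← hk, FiniteField.pow_card]
  -- value on fixed points
  have hE : ∀ c : F, c ≠ 0 → φ c = c → χ c = 1 := by
    intro c hc h
    have := aux_char hF k hk c hc 1 (Or.inl rfl) (by rw [← hφ, h]; simp)
    simp [hχ, MulChar.ringHomComp_apply, this]
  have hK : ∀ c : F, c ≠ 0 → φ c = -c → χ c = (-1) ^ (k + 1) := by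
    intro c hc h
    have := aux_char hF k hk c hc (-1) (Or.inr rfl) (by rw [← hφ, h]; simp)
    simp [hχ, MulChar.ringHomComp_apply, this]
  -- an anti-fixed element
  obtain ⟨z, hz0, hz⟩ : ∃ z : F, z ≠ 0 ∧ φ z = -z := by
    obtain ⟨g, hg⟩ := FiniteField.exists_nonsquare hF
    have hg0 : g ≠ 0 := by rintro rfl; exact hg (IsSquare.zero)
    have hgp : g ^ (Fintype.card F / 2) = -1 := by
      rcases FiniteField.pow_dichotomy hF hg0 with h | h
      · exact absurd ((FiniteField.isSquare_iff hF hg0).mpr h) hg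
      · exact h
    have h2 : Fintype.card F / 2 = (k + 1) * (2 * k) := by
      rw [hk]
      have : (2 * k + 1) ^ 2 = 2 * ((k + 1) * (2 * k)) + 1 := by ring
      omega
    refine ⟨g ^ (k + 1), pow_ne_zero _ hg0, ?_⟩
    rw [hφ, pow_succ, ← pow_mul, ← h2, hgp]; ring
  let E : Subfield F := RingHom.eqLocusField φ (RingHom.id F)
  have memE : ∀ x, x ∈ E ↔ φ x = x := fun x => Iff.rfl
  set G := gaussSum χ Ψ with hG
  -- inner sums
  have inner : ∀ x : F, ∑ c : E, Ψ (c * x) = if φ x = -x then (Fintype.card E : ℂ) else 0 := by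
    intro x
    let θ : AddChar E ℂ := (AddChar.mulShift Ψ x).compAddMonoidHom (E.subtype : E →+ F)
    have hθ : ∀ c : E, θ c = Ψ (c * x) := by
      intro c; simp [θ, AddChar.mulShift_apply, mul_comm]
    have hs : ∑ c : E, Ψ (c * x) = ∑ c : E, θ c := by simp [hθ]
    rw [hs, AddChar.sum_eq_ite]
    refine if_congr ?_ rfl rfl
    constructor
    · intro h
      have h1 : ∀ c : F, φ c = c → Ψ (c * x) = 1 := by
        intro c hc
        rw [← hθ ⟨c, hc⟩, h]; simp
      by_contra hne
      have hy : x + φ x ≠ 0 := fun h' => hne (by linear_combination h')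
      have hy2 : (2 * (x + φ x)) ≠ 0 := mul_ne_zero h2 hy
      apply hprim hy2
      ext w
      rw [AddChar.mulShift_apply, AddChar.one_apply]
      have e : 2 * (x + φ x) * w = w * (x + φ x) + w * (x + φ x) := by ring
      have e2 : Ψ (w * (x + φ x)) = Ψ (φ w * (x + φ x)) := by
        rw [← hinv (w * (x + φ x))]
        congr 1
        rw [map_mul, map_add, hφφ]; ring
      rw [e, AddChar.map_add_eq_mul]
      nth_rw 2 [e2]
      have hfix : φ (w + φ w) = w + φ w := by rw [map_add, hφφ, add_comm]
      have e3 : Ψ ((w + φ w) * φ x) = 1 := by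
        rw [← h1 _ hfix, ← hinv ((w + φ w) * x), map_mul φ, hfix]
      rw [← AddChar.map_add_eq_mul]
      have e4 : w * (x + φ x) + φ w * (x + φ x) = (w + φ w) * x + (w + φ w) * φ x := by ring
      rw [e4, AddChar.map_add_eq_mul, h1 _ hfix, e3, one_mul]
    · intro h
      ext c
      rw [hθ]
      have hc : φ (c : F) = c := c.2
      have e : Ψ ((c : F) * x) = Ψ (-((c : F) * x)) := by
        rw [← hinv ((c : F) * x), map_mul, hc, h]; congr 1; ring
      -- `2 • (c x / 2)`
      have hh : φ ((c : F) * x / 2) = - ((c : F) * x / 2) := by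
        rw [map_div₀, map_mul, hc, h, map_ofNat]; ring
      have e5 : Ψ ((c : F) * x / 2) = Ψ (-((c : F) * x / 2)) := by
        rw [← hh, hinv]
      have e6 : (c : F) * x = (c : F) * x / 2 + (c : F) * x / 2 := by field_simp; ring
      rw [e6, AddChar.map_add_eq_mul]
      nth_rw 1 [e5]
      rw [← AddChar.map_add_eq_mul]
      simp
  -- double sum
  have hGc : ∀ c : E, c ≠ 0 → ∑ x, χ x * Ψ (c * x) = G := by
    intro c hc
    have hc0 : (c : F) ≠ 0 := by simpa using hc
    have := gaussSum_mulShift χ Ψ (Units.mk0 (c : F) hc0)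
    rw [Units.val_mk0, hE c hc0 c.2, one_mul] at this
    rw [hG, ← this]
    simp [gaussSum, AddChar.mulShift_apply]
  have hsum0 : ∑ x, χ x = 0 := MulChar.sum_eq_zero_of_ne_one hχ1
  have hD1 : ∑ c : E, ∑ x, χ x * Ψ (c * x) = ((Fintype.card E : ℂ) - 1) * G := by
    rw [← Finset.add_sum_erase _ _ (Finset.mem_univ (0 : E))]
    rw [Finset.sum_congr rfl (fun c hc => hGc c (Finset.ne_of_mem_erase hc))]
    simp [hsum0, Finset.card_erase_of_mem, Nat.cast_sub (Fintype.card_pos (α := E))]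
  have hD2 : ∑ c : E, ∑ x, χ x * Ψ (c * x)
      = (Fintype.card E : ℂ) * ∑ x with φ x = -x, χ x := by
    rw [Finset.sum_comm]
    simp_rw [← Finset.mul_sum, inner]
    rw [Finset.mul_sum, Finset.sum_filter]
    refine Finset.sum_congr rfl fun x _ => ?_
    split_ifs <;> ring
  have hD3 : ∑ x with φ x = -x, χ x = ((Fintype.card E : ℂ) - 1) * (-1) ^ (k + 1) := by
    have : ∑ x with φ x = -x, χ x = ∑ c : E, χ (z * c) := by
      symm
      refine Finset.sum_bij (fun c _ => z * (c : F)) ?_ ?_ ?_ ?_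
      · intro c _
        have hc : φ (c : F) = c := c.2
        simp [hz, hc]
      · intro a _ b _ h
        exact Subtype.ext (mul_left_cancel₀ hz0 h)
      · intro b hb
        have hb' : φ b = -b := by simpa using hb
        refine ⟨⟨b / z, ?_⟩, Finset.mem_univ _, ?_⟩
        · rw [memE, map_div₀, hb', hz, neg_div_neg_eq]
        · field_simp
      · intros; rfl
    rw [this, ← Finset.add_sum_erase _ _ (Finset.mem_univ (0 : E))]
    have : ∀ c ∈ Finset.univ.erase (0 : E), χ (z * c) = (-1) ^ (k + 1) := by
      intro c hc
      have hc0 : (c : F) ≠ 0 := by simpa using Finset.ne_of_mem_erase hc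
      rw [map_mul, hK z hz0 hz, hE c hc0 c.2, mul_one]
    rw [Finset.sum_congr rfl this]
    have hχ0 : χ 0 = 0 := MulChar.map_zero χ
    simp [hχ0, Finset.card_erase_of_mem, Nat.cast_sub (Fintype.card_pos (α := E))]
  have hcard1 : ((Fintype.card E : ℂ) - 1) ≠ 0 := by
    have : 1 < Fintype.card E := Fintype.one_lt_card
    rw [sub_ne_zero]
    exact_mod_cast this.ne'
  have hGE : G = (-1) ^ (k + 1) * (Fintype.card E : ℂ) := by
    apply mul_left_cancel₀ hcard1
    rw [← hD1, hD2, hD3]; ring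
  have hsq := gaussSum_sq hχ1 hχq hprim
  rw [← hG, hGE, hE (-1) (by simp) (by simp), hk, mul_pow, ← pow_mul, mul_comm (k + 1) 2,
    pow_mul] at hsq
  have hEQ : Fintype.card E = 2 * k + 1 := by
    have : (Fintype.card E) ^ 2 = (2 * k + 1) ^ 2 := by
      have h3 : ((Fintype.card E : ℂ)) ^ 2 = ((2 * k + 1 : ℕ) : ℂ) ^ 2 := by
        simpa using hsq
      exact_mod_cast h3
    exact Nat.pow_left_injective (n := 2) (by norm_num) this
  rw [hGE, hEQ]; push_cast; ring

/-- Quadratic exponential sum as a Gauss sum. -/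
lemma aux_sq {F : Type} [Field F] [Fintype F] [DecidableEq F] (hF : ringChar F ≠ 2)
    (Ψ : AddChar F ℂ) (hΨ : Ψ ≠ 1) :
    ∑ x, Ψ (x ^ 2) = gaussSum ((quadraticChar F).ringHomComp (Int.castRingHom ℂ)) Ψ := by
  have h1 : ∑ x, Ψ (x ^ 2) = ∑ y : F, ∑ x with x ^ 2 = y, Ψ (x ^ 2) :=
    (Finset.sum_fiberwise _ _ _).symm
  have h2 : ∀ y : F, ∑ x with x ^ 2 = y, Ψ (x ^ 2)
      = (quadraticChar F y : ℂ) * Ψ y + Ψ y := by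
    intro y
    rw [Finset.sum_congr rfl (g := fun _ => Ψ y)
      (fun x hx => by rw [(Finset.mem_filter.mp hx).2])]
    have := quadraticChar_card_sqrts hF y
    have h3 : ((Finset.univ.filter fun x : F => x ^ 2 = y).card : ℤ)
        = quadraticChar F y + 1 := by
      rw [← this]; congr 2; ext; simp
    have h4 : ((Finset.univ.filter fun x : F => x ^ 2 = y).card : ℂ)
        = (quadraticChar F y : ℂ) + 1 := by exact_mod_cast h3
    rw [Finset.sum_const, nsmul_eq_mul, h4]; ring
  rw [h1, Finset.sum_congr rfl (fun y _ => h2 y), Finset.sum_add_distrib,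
    AddChar.sum_eq_zero_of_ne_one hΨ, add_zero]
  simp [gaussSum, MulChar.ringHomComp_apply]


open Classical in
/-- **Twisted quadratic Gauss sums over the field with `p^(2m)` elements.**
Let `p` be an odd prime, `m ≥ 1`, `F` the finite field with `p^(2m)` elements,
`ψ : 𝔽_p → ℂ^×` a non-trivial additive character, and `χ` the quadratic character of
`F` (`χ(r) = 1` if `r` is a non-zero square, `−1` otherwise).  Then for every
`r ∈ F^×`, `Σ_{x ∈ F} ψ(Tr_{F/𝔽_p}(r x²)) = −((−1)^((p−1)/2) p)^m · χ(r)`. -/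
theorem stmt_18 (p m : ℕ) (hp : p.Prime) (hp2 : Odd p) (hm : 1 ≤ m)
    (F : Type) [Field F] [Fintype F] [Algebra (ZMod p) F]
    (hF : Fintype.card F = p ^ (2 * m))
    (ψ : AddChar (ZMod p) ℂ) (hψ : ψ ≠ 1) (r : F) (hr : r ≠ 0) :
    ∑ x : F, ψ (Algebra.trace (ZMod p) F (r * x ^ 2)) =
      -(((-1 : ℂ) ^ ((p - 1) / 2) * (p : ℂ)) ^ m) *
        (if ∃ y : F, y ^ 2 = r then 1 else -1) := by
  have : Fact p.Prime := ⟨hp⟩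
  have hpne : p ≠ 2 := by rintro rfl; exact absurd hp2 (by decide)
  have : CharP F p := charP_of_injective_algebraMap (algebraMap (ZMod p) F).injective p
  have hchar : ringChar F ≠ 2 := by rw [ringChar.eq F p]; exact hpne
  obtain ⟨k, hk⟩ : Odd (p ^ m) := hp2.pow
  have hcard : Fintype.card F = (2 * k + 1) ^ 2 := by rw [hF, ← hk, ← pow_mul, mul_comm]
  let Ψ : AddChar F ℂ := ψ.compAddMonoidHom (Algebra.trace (ZMod p) F).toAddMonoidHom
  have hΨa : ∀ x, Ψ x = ψ (Algebra.trace (ZMod p) F x) := fun x => rfl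
  have hΨ : Ψ ≠ 1 := by
    intro h
    apply hψ
    ext a
    obtain ⟨b, hb⟩ := Algebra.trace_surjective (ZMod p) F a
    rw [← hb, ← hΨa, h]; simp
  let f : F ≃ₐ[ZMod p] F := (FiniteField.frobeniusAlgEquivOfAlgebraic (ZMod p) F) ^ m
  have hf : ∀ x, f x = x ^ (2 * k + 1) := by
    intro x
    simp only [f, AlgEquiv.coe_pow, FiniteField.coe_frobeniusAlgEquivOfAlgebraic_iterate,
      ZMod.card, hk]
  have hG := aux_main hchar k hcard (f : F →+* F) hf Ψ hΨ (by
    intro x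
    rw [hΨa, hΨa]
    congr 1
    exact Algebra.trace_eq_of_algEquiv f x)
  set χ := (quadraticChar F).ringHomComp (Int.castRingHom ℂ) with hχ
  have hprim : Ψ.IsPrimitive := AddChar.IsPrimitive.of_ne_one hΨ
  have h1 : ∑ x : F, ψ (Algebra.trace (ZMod p) F (r * x ^ 2)) = gaussSum χ (Ψ.mulShift r) := by
    rw [← aux_sq hchar _ (hprim hr)]
    rfl
  have hχq : χ.IsQuadratic := (quadraticChar_isQuadratic F).comp _
  have h2 := gaussSum_mulShift_eq χ Ψ (Units.mk0 r hr)
  rw [hχq.inv, Units.val_mk0] at h2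
  have hχr : χ r = if ∃ y : F, y ^ 2 = r then 1 else -1 := by
    rw [hχ, MulChar.ringHomComp_apply]
    have : (∃ y : F, y ^ 2 = r) ↔ IsSquare r := by
      rw [isSquare_iff_exists_sq]; simp only [eq_comm]
    split_ifs with h
    · rw [(quadraticChar_one_iff_isSquare hr).mpr (this.mp h)]; simp
    · rw [quadraticChar_neg_one_iff_not_isSquare.mpr (fun h' => h (this.mpr h'))]; simp
  rw [h1, h2, hG, hχr]
  have hs : ((-1 : ℂ) ^ k) = ((-1) ^ ((p - 1) / 2)) ^ m := by
    obtain ⟨j, rfl⟩ := hp2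
    have hj : (2 * j + 1 - 1) / 2 = j := by omega
    rw [hj, ← pow_mul]
    -- parity of `k` versus `j * m`
    have hpar : ∀ m k : ℕ, (2 * j + 1) ^ m = 2 * k + 1 → (-1 : ℂ) ^ k = (-1) ^ (j * m) := by
      intro m
      induction m with
      | zero => intro k hk; have : k = 0 := by simpa using hk.symm
                simp [this]
      | succ n ih =>
        intro k hk
        obtain ⟨l, hl⟩ : Odd ((2 * j + 1) ^ n) := (odd_two_mul_add_one j).pow
        rw [pow_succ, hl] at hk
        have : k = 2 * (l * j) + l + j := by linarith [hk, mul_comm l j, (by ring : (2 * l + 1) * (2 * j + 1) = 2 * (2 * (l * j) + l + j) + 1)]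
        rw [this, pow_add, pow_add, ih l hl, pow_mul]; simp [mul_add, pow_add]
    exact hpar m k hk
  have hpm : (p : ℂ) ^ m = 2 * k + 1 := by exact_mod_cast hk
  rw [mul_pow, ← hs, hpm, pow_succ]
  ring
end

section
/- Let p be an odd prime, e ≥ 1, n = p^e n' with n' a positive integer prime to p and n ≥ 3. Let ψ : F_p → ℂ^× be a non-trivial additive character and set g = Σ_{x ∈ F_p} ψ(x²). Let ν be the quadratic form on F_p^{n−2} given by ν(y₁,…,y_{n−2}) = −(1/n') Σ_{1 ≤ i ≤ j ≤ n−2} y_i y_j. Then Σ_{y ∈ F_p^{n−2}} ψ( ν(y) ) = χ_p( −(−2n')^n ) · g^{n−2}, where χ_p is the Legendre symbol modulo p. -/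
open Finset in
lemma aux_quad {p : ℕ} [Fact p.Prime] (hp2 : Odd p) (ψ : AddChar (ZMod p) ℂ)
    (hψ : ψ ≠ 1) : ∃ Γ : ℂ, Γ ≠ 0 ∧ ∀ a : ZMod p, a ≠ 0 →
      ∑ x : ZMod p, ψ (a * x ^ 2) = ((quadraticChar (ZMod p) a : ℤ) : ℂ) * Γ := by
  have hc : ringChar (ZMod p) ≠ 2 := by
    rw [ZMod.ringChar_zmod_n]
    rintro rfl
    exact absurd hp2 (by decide)
  set χ : MulChar (ZMod p) ℂ := (quadraticChar (ZMod p)).ringHomComp (Int.castRingHom ℂ) with hχ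
  have hχ1 : χ ≠ 1 := by
    obtain ⟨a, ha⟩ := quadraticChar_exists_neg_one hc
    intro h
    have h2 : χ a = -1 := by simp [hχ, MulChar.ringHomComp_apply, ha]
    have ha0 : IsUnit a := by
      rw [isUnit_iff_ne_zero]
      rintro rfl
      simp at ha
    rw [h, MulChar.one_apply ha0] at h2
    norm_num at h2
  refine ⟨gaussSum χ ψ, ?_, ?_⟩
  · apply gaussSum_ne_zero_of_nontrivial _ hχ1 (AddChar.IsPrimitive.of_ne_one hψ)
    simpa using (Fact.out : p.Prime).ne_zero
  · intro a ha
    have h1 : ∑ x : ZMod p, ψ (a * x ^ 2) = ∑ t : ZMod p, (χ t + 1) * ψ (a * t) := by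
      rw [← Finset.sum_fiberwise (s := univ) (g := fun x : ZMod p => x ^ 2)]
      refine Finset.sum_congr rfl fun t _ => ?_
      have h2 := quadraticChar_card_sqrts hc t
      have h3 : ∀ x ∈ univ.filter (fun x : ZMod p => x ^ 2 = t),
          ψ (a * x ^ 2) = ψ (a * t) := by
        intro x hx
        rw [(Finset.mem_filter.1 hx).2]
      rw [Finset.sum_congr rfl h3, Finset.sum_const, nsmul_eq_mul]
      congr 1
      have h4 : ((#{x : ZMod p | x ^ 2 = t}.toFinset : ℤ) : ℂ) = χ t + 1 := by
        rw [h2]; simp [hχ, MulChar.ringHomComp_apply]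
      rw [← h4]
      simp
    have h5 : ∑ t : ZMod p, ψ (a * t) = 0 := by
      have := AddChar.sum_mulShift a (AddChar.IsPrimitive.of_ne_one hψ)
      simpa [ha, mul_comm] using this
    have h6 := gaussSum_mulShift χ ψ (Units.mk0 a ha)
    have h7 : χ a * χ a = 1 := by
      have := quadraticChar_sq_one ha
      rw [sq] at this
      simp only [hχ, MulChar.ringHomComp_apply]
      simp only [eq_intCast]
      exact_mod_cast this
    have h8 : ∑ t : ZMod p, χ t * ψ (a * t) = gaussSum χ (ψ.mulShift a) := by
      simp [gaussSum, AddChar.mulShift_apply]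
    rw [h1]
    simp only [add_mul, one_mul, Finset.sum_add_distrib, h5, add_zero]
    rw [h8]
    change _ = χ a * _
    rw [← h6, Units.val_mk0, ← mul_assoc, h7, one_mul]

lemma aux_complete {p : ℕ} [Fact p.Prime] (h2 : (2 : ZMod p) ≠ 0) (ψ : AddChar (ZMod p) ℂ)
    (a b : ZMod p) (ha : a ≠ 0) :
    ∑ x : ZMod p, ψ (a * x ^ 2 + b * x) =
      ψ (-(b ^ 2) / (4 * a)) * ∑ x : ZMod p, ψ (a * x ^ 2) := by
  rw [Finset.mul_sum, ← Equiv.sum_comp (Equiv.addRight (b / (2 * a)))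
    (fun x => ψ (-(b ^ 2) / (4 * a)) * ψ (a * x ^ 2))]
  refine Finset.sum_congr rfl fun x _ => ?_
  rw [← AddChar.map_add_eq_mul]
  congr 1
  have h4 : (4 : ZMod p) ≠ 0 := by
    have := mul_ne_zero h2 h2
    norm_num at this
    exact this
  simp only [Equiv.coe_addRight]
  field_simp
  ring

lemma aux_form {R : Type*} [CommRing R] (m : ℕ) (y : Fin m → R) :
    2 * ∑ q ∈ Finset.univ.filter (fun q : Fin m × Fin m => q.1 ≤ q.2), y q.1 * y q.2 =
      ∑ i, y i ^ 2 + (∑ i, y i) ^ 2 := by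
  have e1 : ∑ q ∈ Finset.univ.filter (fun q : Fin m × Fin m => q.1 ≤ q.2), y q.1 * y q.2 =
      ∑ i, ∑ j, if i ≤ j then y i * y j else 0 := by
    rw [Finset.sum_filter, Fintype.sum_prod_type]
  have e2 : ∑ i, ∑ j, (if i ≤ j then y i * y j else 0) =
      ∑ i, ∑ j, (if j ≤ i then y i * y j else 0) := by
    rw [Finset.sum_comm]
    simp only [mul_comm]
  have e3 : ∑ i, y i ^ 2 = ∑ i, ∑ j, (if i = j then y i * y j else 0) := by
    simp [sq]
  rw [e1, two_mul]
  nth_rewrite 2 [e2]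
  rw [e3, sq, Finset.sum_mul_sum]
  simp only [← Finset.sum_add_distrib]
  refine Finset.sum_congr rfl fun i _ => Finset.sum_congr rfl fun j _ => ?_
  rcases lt_trichotomy i j with h | h | h
  · simp [h.le, h.ne, h.not_ge]
  · simp [h]
  · simp [h.le, h.ne', h.not_ge]

lemma aux_addChar_sum {A ι : Type*} [AddCommMonoid A] (ψ : AddChar A ℂ) (s : Finset ι)
    (f : ι → A) : ψ (∑ i ∈ s, f i) = ∏ i ∈ s, ψ (f i) := by
  classical
  induction s using Finset.induction_on with
  | empty => simp
  | insert a s ha ih => rw [Finset.sum_insert ha, Finset.prod_insert ha,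
      AddChar.map_add_eq_mul, ih]

lemma aux_main_s19 {p : ℕ} [Fact p.Prime] (h2 : (2 : ZMod p) ≠ 0) (ψ : AddChar (ZMod p) ℂ)
    (m : ℕ) (hm : (m : ZMod p) = -2) (c : ZMod p) (hc : c ≠ 0) :
    (∑ t : ZMod p, ψ ((-1 / (4 * c)) * t ^ 2)) *
      ∑ y : Fin m → ZMod p, ψ (c * (∑ i, y i ^ 2 + (∑ i, y i) ^ 2)) =
    (∑ x : ZMod p, ψ (c * x ^ 2)) ^ m * ∑ t : ZMod p, ψ ((1 / (4 * c)) * t ^ 2) := by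
  have h4 : (4 : ZMod p) ≠ 0 := by
    have := mul_ne_zero h2 h2
    norm_num at this
    exact this
  have hd : (-1 / (4 * c)) ≠ 0 := by
    apply div_ne_zero (by simp) (mul_ne_zero h4 hc)
  have key : ∀ y : Fin m → ZMod p,
      (∑ t : ZMod p, ψ ((-1 / (4 * c)) * t ^ 2)) *
        ψ (c * (∑ i, y i ^ 2 + (∑ i, y i) ^ 2)) =
      ∑ t : ZMod p, ψ ((-1 / (4 * c)) * t ^ 2) * ∏ i, ψ (c * y i ^ 2 + t * y i) := by
    intro y
    have := aux_complete h2 ψ _ (∑ i, y i) hd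
    rw [mul_add, AddChar.map_add_eq_mul]
    have e : -(∑ i, y i) ^ 2 / (4 * (-1 / (4 * c))) = c * (∑ i, y i) ^ 2 := by
      field_simp
    rw [e] at this
    rw [mul_comm, mul_assoc, ← this, Finset.mul_sum]
    refine Finset.sum_congr rfl fun t _ => ?_
    rw [← aux_addChar_sum, ← AddChar.map_add_eq_mul, ← AddChar.map_add_eq_mul]
    congr 1
    rw [Finset.sum_add_distrib, ← Finset.mul_sum, ← Finset.mul_sum]
    ring
  rw [Finset.mul_sum, Finset.sum_congr rfl (fun y _ => key y), Finset.sum_comm, Finset.mul_sum]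
  refine Finset.sum_congr rfl fun t _ => ?_
  rw [← Finset.mul_sum, ← Fintype.sum_pow (fun x => ψ (c * x ^ 2 + t * x)),
    aux_complete h2 ψ c t hc, mul_pow, ← AddChar.map_nsmul_eq_pow, ← mul_assoc,
    ← AddChar.map_add_eq_mul, mul_comm]
  congr 2
  rw [nsmul_eq_mul, hm]
  ring

/-- **Gauss sum of the quadratic form `ν(y) = −(1/n') Σ_{1≤i≤j≤n−2} y_i y_j`.**
Let `p` be an odd prime, `e ≥ 1`, `n = p^e n'` with `p ∤ n'` and `n ≥ 3`, let
`ψ : 𝔽_p → ℂ^×` be a non-trivial additive character, and let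
`g = Σ_{x ∈ 𝔽_p} ψ(x²)` be the quadratic Gauss sum.  Then
`Σ_{y ∈ 𝔽_p^(n−2)} ψ(ν(y)) = χ_p(−(−2n')^n) · g^(n−2)`,
where `χ_p` is the Legendre symbol modulo `p`. -/
theorem stmt_19 (p e n n' : ℕ) [Fact p.Prime] (hp2 : Odd p) (he : 1 ≤ e)
    (hn' : ¬ p ∣ n') (hn'pos : 1 ≤ n') (hn : n = p ^ e * n') (hn3 : 3 ≤ n)
    (ψ : AddChar (ZMod p) ℂ) (hψ : ψ ≠ 1) :
    ∑ y : Fin (n - 2) → ZMod p,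
        ψ (-(1 / (n' : ZMod p)) *
          ∑ q ∈ Finset.univ.filter (fun q : Fin (n - 2) × Fin (n - 2) => q.1 ≤ q.2),
            y q.1 * y q.2) =
      (legendreSym p (-(-2 * (n' : ℤ)) ^ n) : ℂ) * (∑ x : ZMod p, ψ (x ^ 2)) ^ (n - 2) := by
  have hpp : p.Prime := Fact.out
  have h2 : (2 : ZMod p) ≠ 0 := by
    intro h
    have h' : ((2 : ℕ) : ZMod p) = 0 := by exact_mod_cast h
    rw [ZMod.natCast_eq_zero_iff, Nat.prime_dvd_prime_iff_eq hpp Nat.prime_two] at h'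
    subst h'
    exact absurd hp2 (by decide)
  have hn0 : (n' : ZMod p) ≠ 0 := by
    rwa [Ne, ZMod.natCast_eq_zero_iff]
  obtain ⟨m, rfl⟩ : ∃ m, n = m + 2 := ⟨n - 2, by omega⟩
  have hm : (m : ZMod p) = -2 := by
    have h0 : ((m + 2 : ℕ) : ZMod p) = 0 := by
      rw [ZMod.natCast_eq_zero_iff, hn]
      exact Dvd.dvd.mul_right (dvd_pow_self p (by omega)) _
    push_cast at h0
    exact eq_neg_of_add_eq_zero_left h0
  change ∑ y : Fin m → ZMod p,
        ψ (-(1 / (n' : ZMod p)) *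
          ∑ q ∈ Finset.univ.filter (fun q : Fin m × Fin m => q.1 ≤ q.2),
            y q.1 * y q.2) =
      (legendreSym p (-(-2 * (n' : ℤ)) ^ (m + 2)) : ℂ) * (∑ x : ZMod p, ψ (x ^ 2)) ^ m
  obtain ⟨Γ, hΓ, hG⟩ := aux_quad hp2 ψ hψ
  set c : ZMod p := -1 / (2 * n') with hcdef
  have hc : c ≠ 0 := div_ne_zero (by simp) (mul_ne_zero h2 hn0)
  have h4 : (4 : ZMod p) ≠ 0 := by
    have := mul_ne_zero h2 h2
    norm_num at this
    exact this
  have hmain := aux_main_s19 h2 ψ m hm c hc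
  have hS : ∀ y : Fin m → ZMod p, -(1 / (n' : ZMod p)) *
          ∑ q ∈ Finset.univ.filter (fun q : Fin m × Fin m => q.1 ≤ q.2), y q.1 * y q.2 =
        c * (∑ i, y i ^ 2 + (∑ i, y i) ^ 2) := by
    intro y
    rw [← aux_form, hcdef]
    field_simp
  simp only [hS]
  have hg : ∑ x : ZMod p, ψ (x ^ 2) = Γ := by
    have := hG 1 one_ne_zero
    simpa using this
  rw [hg]
  rw [hG _ hc, hG _ (div_ne_zero (by simp) (mul_ne_zero h4 hc)),
    hG _ (div_ne_zero (by simp) (mul_ne_zero h4 hc))] at hmain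
  set S := ∑ y : Fin m → ZMod p, ψ (c * (∑ i, y i ^ 2 + (∑ i, y i) ^ 2))
  have q1 : quadraticChar (ZMod p) (1 / (4 * c)) = quadraticChar (ZMod p) c := by
    have e : 1 / (4 * c) = c * (1 / (2 * c)) ^ 2 := by field_simp; norm_num
    rw [e, map_mul, quadraticChar_sq_one' (div_ne_zero (by simp) (mul_ne_zero h2 hc)), mul_one]
  have q2 : quadraticChar (ZMod p) (-1 / (4 * c)) =
      quadraticChar (ZMod p) (-1) * quadraticChar (ZMod p) c := by
    rw [← q1, ← map_mul]; congr 1; ring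
  have q3 : quadraticChar (ZMod p) (-2 * n') = quadraticChar (ZMod p) c := by
    have e : (-2 * n' : ZMod p) = c * (2 * n') ^ 2 := by rw [hcdef]; field_simp
    rw [e, map_mul, quadraticChar_sq_one' (mul_ne_zero h2 hn0), mul_one]
  have q4 : legendreSym p (-(-2 * (n' : ℤ)) ^ (m + 2)) =
      quadraticChar (ZMod p) (-1) * quadraticChar (ZMod p) c ^ (m + 2) := by
    rw [legendreSym, ← q3, ← map_pow, ← map_mul]
    congr 1
    push_cast
    ring
  have q5 : quadraticChar (ZMod p) (-1) ^ 2 = 1 := quadraticChar_sq_one (by simp)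
  have q6 : quadraticChar (ZMod p) c ^ 2 = 1 := quadraticChar_sq_one hc
  rw [q1, q2] at hmain
  rw [q4]
  generalize quadraticChar (ZMod p) (-1) = u at *
  generalize quadraticChar (ZMod p) c = v at *
  have r5 : (u : ℂ) ^ 2 = 1 := by exact_mod_cast q5
  have r6 : (v : ℂ) ^ 2 = 1 := by exact_mod_cast q6
  push_cast at hmain ⊢
  apply mul_left_cancel₀ hΓ
  rw [mul_pow] at hmain
  linear_combination (u * v : ℂ) * hmain + (-Γ * S * v ^ 2) * r5 + (-Γ * S) * r6
end
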